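/- arXiv:1402.0229 — 2 statements merged into one kernel-verified Lean document; each statement's English description precedes it below -/
import Mathlib

section
/- Let 1 ≤ m < n. Then Σ_λ ∏_{j=1}^{n−ℓ(λ)} (1−t^j) · b_λ(t) · P_λ(x_1,…,x_m;t) · P_λ(y_1,…,y_n;t) = ( ∏_{i=1}^{n−m} (1−t^i) · ∏_{i=1}^{m} ∏_{j=1}^{n} (1−t x_i y_j) ) / ( ∏_{i=1}^{m} x_i^{n−m} · Δ(x)_m Δ(y)_n ) · det[ 𝒜°_{i,j} ]_{1≤i,j≤n}, where the sum is over all partitions λ with ℓ(λ) ≤ m, 𝒜°_{i,j} = (1−t)/((1−x_i y_j)(1−t x_i y_j)) for 1 ≤ i ≤ m, and 𝒜°_{i,j} = y_j^{n−i} for m+1 ≤ i ≤ n. -/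
noncomputable section

open scoped BigOperators

/-- The Vandermonde product `Δ(x)ₙ = ∏_{i<j} (x i - x j)`. -/
def vprod {n : ℕ} (x : Fin n → ℂ) : ℂ :=
  ∏ i : Fin n, ∏ j ∈ Finset.Ioi i, (x i - x j)

/-- `mult l i` is the multiplicity `m_i(λ)` of the part `i` in the partition `λ` recorded
by `l : Fin n → ℕ`; in particular `mult l 0 = n - ℓ(λ)`. -/
def mult {n : ℕ} (l : Fin n → ℕ) (i : ℕ) : ℕ :=
  (Finset.univ.filter fun k => l k = i).card

/-- The number of nonzero parts `ℓ(λ)`. -/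
def len {n : ℕ} (l : Fin n → ℕ) : ℕ :=
  (Finset.univ.filter fun k => l k ≠ 0).card

/-- `v_λ(t) = ∏_{i≥0} ∏_{j=1}^{m_i(λ)} (1-t^j)/(1-t)`, with `m₀(λ) = n - ℓ(λ)`. -/
def vlam {n : ℕ} (l : Fin n → ℕ) (t : ℂ) : ℂ :=
  ∏ i ∈ Finset.range (Finset.univ.sup l + 1),
    ∏ j ∈ Finset.range (mult l i), ((1 - t ^ (j + 1)) / (1 - t))

/-- The Hall–Littlewood polynomial
`P_λ(x₁,…,xₙ;t) = v_λ(t)⁻¹ Σ_{σ∈Sₙ} σ(x₁^{λ₁}⋯xₙ^{λₙ} ∏_{i<j} (xᵢ-t xⱼ)/(xᵢ-xⱼ))`. -/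
def hallLittlewood {n : ℕ} (l : Fin n → ℕ) (x : Fin n → ℂ) (t : ℂ) : ℂ :=
  (vlam l t)⁻¹ *
    ∑ σ : Equiv.Perm (Fin n),
      (∏ i : Fin n, x (σ i) ^ l i) *
        ∏ i : Fin n, ∏ j ∈ Finset.Ioi i, (x (σ i) - t * x (σ j)) / (x (σ i) - x (σ j))

/-- `b_λ(t) = ∏_{i≥1} ∏_{j=1}^{m_i(λ)} (1-t^j)`. -/
def bfac {n : ℕ} (l : Fin n → ℕ) (t : ℂ) : ℂ :=
  ∏ i ∈ Finset.Icc 1 (Finset.univ.sup l),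
    ∏ j ∈ Finset.range (mult l i), (1 - t ^ (j + 1))

/-- The product `∏_{i ∈ S} (p - t i) / (p - i)`. -/
def psi (t p : ℂ) (S : Finset ℂ) : ℂ := ∏ i ∈ S, (p - t * i) / (p - i)

/-- The `t`-Pochhammer symbol `(t; t)_n`. -/
def phi (t : ℂ) (n : ℕ) : ℂ := ∏ i ∈ Finset.range n, (1 - t ^ (i + 1))

/-- The factor `∏_{i ∈ S} (1 - t i y) / (1 - i y)` of the Hall–Littlewood Cauchy kernel. -/
def kern (t : ℂ) (S : Finset ℂ) (y : ℂ) : ℂ := ∏ i ∈ S, (1 - t * i * y) / (1 - i * y)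

/-- The partial domain wall partition function, defined by removing one `x`-variable at a time. -/
def pdw (t : ℂ) : List ℂ → Finset ℂ → ℂ
  | [], T => phi t T.card
  | a :: s, T => ∑ j ∈ T, (1 - t) / (1 - a * j) *
      (s.map fun i => (1 - t * i * j) / (1 - i * j)).prod * psi t j (T.erase j) *
        pdw t s (T.erase j)

/-- The partial domain wall partition function of two finite sets of variables. -/
def pdwSet (t : ℂ) (S T : Finset ℂ) : ℂ := pdw t S.toList T

theorem phi_succ (t : ℂ) (n : ℕ) : phi t (n + 1) = phi t n * (1 - t ^ (n + 1)) :=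
  Finset.prod_range_succ _ _

theorem psi_insert (t p : ℂ) {q : ℂ} {S : Finset ℂ} (h : q ∉ S) :
    psi t p (insert q S) = (p - t * q) / (p - q) * psi t p S :=
  Finset.prod_insert h

theorem psi_erase (t p : ℂ) {q : ℂ} {S : Finset ℂ} (h : q ∈ S) :
    psi t p S = (p - t * q) / (p - q) * psi t p (S.erase q) :=
  (Finset.mul_prod_erase _ _ h).symm

theorem prod_div_eq_add_sum (α β : ℂ) (Q : Finset ℂ) (z w : ℂ) (h : ∀ i ∈ Q, z - i * w ≠ 0) :
    ∏ i ∈ Q, (α * z - β * i * w) / (z - i * w) =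
      α ^ Q.card + ∑ p ∈ Q, (α - β) * p * w / (z - p * w) *
        ∏ i ∈ Q.erase p, (α * p - β * i) / (p - i) := by
  induction Q using Finset.induction_on generalizing z w with
  | empty => simp
  | insert q Q hq ih =>
    have hz : z - q * w ≠ 0 := h q (Finset.mem_insert_self _ _)
    have hQ : ∀ i ∈ Q, z - i * w ≠ 0 := fun i hi => h i (Finset.mem_insert_of_mem hi)
    have hqQ : ∀ i ∈ Q, q - i ≠ 0 := fun i hi e => hq (by rwa [sub_eq_zero.1 e])
    have h1 := ih q 1 (by simpa using hqQ)
    simp only [mul_one] at h1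
    rw [Finset.prod_insert hq, Finset.sum_insert hq, Finset.erase_insert hq,
      Finset.card_insert_of_notMem hq, ih z w hQ, h1, mul_add, mul_add, Finset.mul_sum,
      Finset.mul_sum]
    have h2 : ∑ p ∈ Q, (α - β) * p * w / (z - p * w) *
          ∏ i ∈ (insert q Q).erase p, (α * p - β * i) / (p - i) =
        ∑ p ∈ Q, ((α * z - β * q * w) / (z - q * w) * ((α - β) * p * w / (z - p * w) *
          ∏ i ∈ Q.erase p, (α * p - β * i) / (p - i)) -
          (α - β) * q * w / (z - q * w) * ((α - β) * p / (q - p) *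
          ∏ i ∈ Q.erase p, (α * p - β * i) / (p - i))) := by
      refine Finset.sum_congr rfl fun p hp => ?_
      have hpq : p ≠ q := fun e => hq (e ▸ hp)
      rw [Finset.erase_insert_of_ne hpq.symm, Finset.prod_insert (by simp [hq])]
      have e1 := hQ p hp
      have e2 := hqQ p hp
      have e3 : p - q ≠ 0 := sub_ne_zero.2 hpq
      generalize ∏ i ∈ Q.erase p, (α * p - β * i) / (p - i) = P
      rw [show q - p = -(p - q) by ring]
      have hz' : z - w * q ≠ 0 := by rwa [mul_comm]
      have e1' : z - w * p ≠ 0 := by rwa [mul_comm]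
      field_simp
      ring
    rw [h2, Finset.sum_sub_distrib]
    have h3 : (α * z - β * q * w) / (z - q * w) * α ^ Q.card =
        α ^ (Q.card + 1) + (α - β) * q * w / (z - q * w) * α ^ Q.card := by
      field_simp
      ring
    rw [h3]
    ring

theorem sum_prod_div_eq (α β : ℂ) (Q : Finset ℂ) :
    ∑ p ∈ Q, (α - β) * ∏ i ∈ Q.erase p, (α * p - β * i) / (p - i) =
      α ^ Q.card - β ^ Q.card := by
  have key : ∀ Q : Finset ℂ, (0 : ℂ) ∉ Q →
      ∑ p ∈ Q, (α - β) * ∏ i ∈ Q.erase p, (α * p - β * i) / (p - i) =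
        α ^ Q.card - β ^ Q.card := by
    intro Q h0
    have hne : ∀ i ∈ Q, i ≠ 0 := fun i hi e => h0 (e ▸ hi)
    have h := prod_div_eq_add_sum α β Q 0 1 (by simpa using hne)
    have h1 : ∏ i ∈ Q, (α * 0 - β * i * 1) / (0 - i * 1) = β ^ Q.card := by
      rw [← Finset.prod_const]
      refine Finset.prod_congr rfl fun i hi => ?_
      have := hne i hi
      field_simp
      ring
    have h2 : ∑ p ∈ Q, (α - β) * p * 1 / (0 - p * 1) *
          ∏ i ∈ Q.erase p, (α * p - β * i) / (p - i) =
        - ∑ p ∈ Q, (α - β) * ∏ i ∈ Q.erase p, (α * p - β * i) / (p - i) := by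
      rw [← Finset.sum_neg_distrib]
      refine Finset.sum_congr rfl fun p hp => ?_
      have := hne p hp
      rw [mul_one, zero_sub, mul_one, div_neg, mul_div_cancel_right₀ _ this]
      ring
    rw [h1, h2] at h
    linear_combination h
  by_cases h0 : (0 : ℂ) ∈ Q
  · obtain ⟨Q, h0', rfl⟩ : ∃ Q', (0 : ℂ) ∉ Q' ∧ insert 0 Q' = Q :=
      ⟨Q.erase 0, by simp, Finset.insert_erase h0⟩
    have hne : ∀ i ∈ Q, i ≠ 0 := fun i hi e => h0' (e ▸ hi)
    rw [Finset.sum_insert h0', Finset.erase_insert h0', Finset.card_insert_of_notMem h0']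
    have h1 : ∏ i ∈ Q, (α * 0 - β * i) / (0 - i) = β ^ Q.card := by
      rw [← Finset.prod_const]
      refine Finset.prod_congr rfl fun i hi => ?_
      have := hne i hi
      field_simp
      ring
    have h2 : ∑ p ∈ Q, (α - β) * ∏ i ∈ (insert 0 Q).erase p, (α * p - β * i) / (p - i) =
        α * ∑ p ∈ Q, (α - β) * ∏ i ∈ Q.erase p, (α * p - β * i) / (p - i) := by
      rw [Finset.mul_sum]
      refine Finset.sum_congr rfl fun p hp => ?_
      have := hne p hp
      rw [Finset.erase_insert_of_ne this.symm, Finset.prod_insert (by simp [h0'])]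
      rw [mul_zero, sub_zero, sub_zero, mul_div_cancel_right₀ _ this]
      ring
    rw [h1, h2, key Q h0']
    ring
  · exact key Q h0

theorem sum_psi_erase (t : ℂ) (T : Finset ℂ) :
    (1 - t) * ∑ p ∈ T, psi t p (T.erase p) = 1 - t ^ T.card := by
  have h := sum_prod_div_eq 1 t T
  simp only [one_mul, one_pow] at h
  rw [← h, Finset.mul_sum]
  rfl

theorem psi_sub_kern (t a y : ℂ) (Q : Finset ℂ) (ha : a ∉ Q) (hy : ∀ i ∈ Q, 1 - i * y ≠ 0) :
    psi t a Q - kern t Q y =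
      ∑ p ∈ Q, (1 - t) * p * (1 - a * y) / ((a - p) * (1 - p * y)) * psi t p (Q.erase p) := by
  have haQ : ∀ i ∈ Q, a - i ≠ 0 := fun i hi e => ha (by rwa [sub_eq_zero.1 e])
  have h1 := prod_div_eq_add_sum 1 t Q a 1 (by simpa using haQ)
  have h2 := prod_div_eq_add_sum 1 t Q 1 y hy
  simp only [one_mul, mul_one] at h1 h2
  rw [psi, kern, h1, h2, add_sub_add_left_eq_sub, ← Finset.sum_sub_distrib]
  refine Finset.sum_congr rfl fun p hp => ?_
  have e1 := haQ p hp
  have e2 := hy p hp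
  rw [psi, ← sub_mul]
  congr 1
  field_simp
  ring

theorem prod_div_sub_one (t a : ℂ) (Q : Finset ℂ) (ha : a ∉ Q) :
    ∏ i ∈ Q, psi t i {a} - 1 =
      ∑ p ∈ Q, (1 - t) * a / (p - a) * ∏ i ∈ Q.erase p, psi t i {p} := by
  have haQ : ∀ i ∈ Q, a - i ≠ 0 := fun i hi e => ha (by rwa [sub_eq_zero.1 e])
  have h1 := prod_div_eq_add_sum t 1 Q a 1 (by simpa using haQ)
  have h2 := sum_prod_div_eq t 1 Q
  have e : ∀ p i : ℂ, psi t i {p} = (t * p - i) / (p - i) := fun p i => by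
    rw [psi, Finset.prod_singleton, ← neg_div_neg_eq]
    congr 1 <;> ring
  simp only [one_mul, mul_one, one_pow] at h1 h2
  simp only [e]
  rw [h1]
  have h3 : t ^ Q.card = 1 + ∑ p ∈ Q, (t - 1) * ∏ i ∈ Q.erase p, (t * p - i) / (p - i) := by
    rw [h2]; ring
  rw [h3, add_assoc, add_sub_cancel_left, ← Finset.sum_add_distrib]
  refine Finset.sum_congr rfl fun p hp => ?_
  have e1 := haQ p hp
  have e2 : p - a ≠ 0 := fun e => e1 (by linear_combination -e)
  rw [← add_mul]
  congr 1
  rw [show a - p = -(p - a) by ring]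
  field_simp
  ring

theorem sum_erase_congr {T : Finset ℂ} {f g : ℂ → ℂ → ℂ}
    (h : ∀ j ∈ T, ∀ k ∈ T, j ≠ k → f j k + f k j = g j k + g k j) :
    ∑ j ∈ T, ∑ k ∈ T.erase j, f j k = ∑ j ∈ T, ∑ k ∈ T.erase j, g j k := by
  have hs : ∀ f : ℂ → ℂ → ℂ,
      ∑ j ∈ T, ∑ k ∈ T.erase j, f j k = ∑ j ∈ T, ∑ k ∈ T.erase j, f k j := fun f =>
    Finset.sum_comm' (by intro x y; simp only [Finset.mem_erase]; tauto)
  have h2 : ∀ f : ℂ → ℂ → ℂ, 2 * ∑ j ∈ T, ∑ k ∈ T.erase j, f j k =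
      ∑ j ∈ T, ∑ k ∈ T.erase j, (f j k + f k j) := fun f => by
    simp only [Finset.sum_add_distrib]
    rw [← hs f, two_mul]
  have h3 : 2 * ∑ j ∈ T, ∑ k ∈ T.erase j, f j k = 2 * ∑ j ∈ T, ∑ k ∈ T.erase j, g j k := by
    rw [h2 f, h2 g]
    refine Finset.sum_congr rfl fun j hj => Finset.sum_congr rfl fun k hk => ?_
    exact h j hj k (Finset.mem_of_mem_erase hk) (Finset.ne_of_mem_erase hk).symm
  exact mul_left_cancel₀ two_ne_zero h3

theorem pdw_swap (t a b : ℂ) (s : List ℂ) (T : Finset ℂ)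
    (ha : ∀ y ∈ T, 1 - a * y ≠ 0) (hb : ∀ y ∈ T, 1 - b * y ≠ 0) :
    pdw t (a :: b :: s) T = pdw t (b :: a :: s) T := by
  simp only [pdw, Finset.mul_sum, List.map_cons, List.prod_cons]
  refine sum_erase_congr fun j hj k hk hjk => ?_
  have hk' : k ∈ T.erase j := Finset.mem_erase.2 ⟨hjk.symm, hk⟩
  have hj' : j ∈ T.erase k := Finset.mem_erase.2 ⟨hjk, hj⟩
  rw [psi_erase t j hk', psi_erase t k hj', Finset.erase_right_comm (a := k) (b := j)]
  have e1 := ha j hj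
  have e2 := ha k hk
  have e3 := hb j hj
  have e4 := hb k hk
  have e5 : j - k ≠ 0 := sub_ne_zero.2 hjk
  rw [show k - j = -(j - k) by ring]
  generalize (s.map fun i => (1 - t * i * j) / (1 - i * j)).prod = Hj
  generalize (s.map fun i => (1 - t * i * k) / (1 - i * k)).prod = Hk
  have e1' : 1 - j * a ≠ 0 := by rwa [mul_comm]
  have e2' : 1 - k * a ≠ 0 := by rwa [mul_comm]
  have e3' : 1 - j * b ≠ 0 := by rwa [mul_comm]
  have e4' : 1 - k * b ≠ 0 := by rwa [mul_comm]
  field_simp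
  ring

theorem pdw_perm (t : ℂ) {s s' : List ℂ} (h : s.Perm s') (T : Finset ℂ)
    (hs : ∀ a ∈ s, ∀ y ∈ T, 1 - a * y ≠ 0) : pdw t s T = pdw t s' T := by
  induction h generalizing T with
  | nil => rfl
  | cons a h ih =>
    simp only [pdw]
    refine Finset.sum_congr rfl fun j _ => ?_
    rw [(h.map _).prod_eq, ih (T.erase j) fun a ha y hy =>
      hs a (List.mem_cons_of_mem _ ha) y (Finset.mem_of_mem_erase hy)]
  | swap a b s => exact pdw_swap t b a s T (hs b (by simp)) (hs a (by simp))
  | trans h₁ _ ih₁ ih₂ => exact (ih₁ T hs).trans (ih₂ T fun a ha => hs a (h₁.mem_iff.2 ha))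

theorem pdw_eq_sum (t : ℂ) (s : List ℂ) (T : Finset ℂ) (hs : ∀ a ∈ s, ∀ y ∈ T, 1 - a * y ≠ 0)
    (hc : s.length < T.card) :
    pdw t s T = ∑ j ∈ T, (1 - t) * (s.map fun i => (1 - t * i * j) / (1 - i * j)).prod *
      psi t j (T.erase j) * pdw t s (T.erase j) := by
  induction s generalizing T with
  | nil =>
    obtain ⟨n, hn⟩ : ∃ n, T.card = n + 1 := ⟨T.card - 1, by rw [List.length_nil] at hc; omega⟩
    have h := sum_psi_erase t T
    simp only [pdw, List.map_nil, List.prod_nil, mul_one]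
    rw [hn, phi_succ, ← hn, ← h, Finset.mul_sum, Finset.mul_sum]
    refine Finset.sum_congr rfl fun j hj => ?_
    rw [Finset.card_erase_of_mem hj, hn, Nat.add_sub_cancel]
    ring
  | cons a s ih =>
    have hcons : pdw t (a :: s) T = ∑ k ∈ T, ∑ j ∈ T.erase k, (1 - t) / (1 - a * k) *
      (s.map fun i => (1 - t * i * k) / (1 - i * k)).prod * psi t k (T.erase k) *
        ((1 - t) * (s.map fun i => (1 - t * i * j) / (1 - i * j)).prod *
      psi t j ((T.erase k).erase j) * pdw t s ((T.erase k).erase j)) := by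
      rw [pdw]
      refine Finset.sum_congr rfl fun k hk => ?_
      rw [ih (T.erase k) (fun b hb y hy => hs b (List.mem_cons_of_mem _ hb) y
        (Finset.mem_of_mem_erase hy)) (by
          rw [Finset.card_erase_of_mem hk]; rw [List.length_cons] at hc; omega), Finset.mul_sum]
    rw [hcons]
    simp only [pdw, Finset.mul_sum, List.map_cons, List.prod_cons]
    refine sum_erase_congr fun j hj k hk hjk => ?_
    have hk' : k ∈ T.erase j := Finset.mem_erase.2 ⟨hjk.symm, hk⟩
    have hj' : j ∈ T.erase k := Finset.mem_erase.2 ⟨hjk, hj⟩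
    rw [psi_erase t j hk', psi_erase t k hj', Finset.erase_right_comm (a := k) (b := j)]
    have e1 := hs a (by simp) j hj
    have e2 := hs a (by simp) k hk
    have e5 : j - k ≠ 0 := sub_ne_zero.2 hjk
    rw [show k - j = -(j - k) by ring]
    generalize (s.map fun i => (1 - t * i * j) / (1 - i * j)).prod = Hj
    generalize (s.map fun i => (1 - t * i * k) / (1 - i * k)).prod = Hk
    have e1' : 1 - j * a ≠ 0 := by rwa [mul_comm]
    have e2' : 1 - k * a ≠ 0 := by rwa [mul_comm]
    field_simp
    ring

theorem pdwSet_empty (t : ℂ) (T : Finset ℂ) : pdwSet t ∅ T = phi t T.card := by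
  simp [pdwSet, pdw]

theorem pdwSet_insert (t : ℂ) {a : ℂ} {S T : Finset ℂ} (ha : a ∉ S)
    (hS : ∀ x ∈ insert a S, ∀ y ∈ T, 1 - x * y ≠ 0) :
    pdwSet t (insert a S) T = ∑ j ∈ T, (1 - t) / (1 - a * j) * kern t S j *
      psi t j (T.erase j) * pdwSet t S (T.erase j) := by
  rw [pdwSet, pdw_perm t (Finset.toList_insert ha) T (by simpa using hS), pdw]
  simp only [kern, Finset.prod_map_toList, pdwSet]

theorem pdwSet_eq_sum (t : ℂ) {S T : Finset ℂ} (hS : ∀ x ∈ S, ∀ y ∈ T, 1 - x * y ≠ 0)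
    (hc : S.card < T.card) :
    pdwSet t S T = ∑ j ∈ T, (1 - t) * kern t S j * psi t j (T.erase j) *
      pdwSet t S (T.erase j) := by
  rw [pdwSet, pdw_eq_sum t _ T (by simpa using hS) (by simpa using hc)]
  simp only [kern, Finset.prod_map_toList, pdwSet]

theorem pdwSet_insert' (t : ℂ) {a : ℂ} {S T : Finset ℂ} (ha : a ∉ S)
    (hS : ∀ x ∈ insert a S, ∀ y ∈ T, 1 - x * y ≠ 0) (hc : S.card < T.card) :
    pdwSet t (insert a S) T = pdwSet t S T + ∑ j ∈ T, a * j * (1 - t) / (1 - a * j) *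
      kern t S j * psi t j (T.erase j) * pdwSet t S (T.erase j) := by
  rw [pdwSet_insert t ha hS, pdwSet_eq_sum t
    (fun x hx => hS x (Finset.mem_insert_of_mem hx)) hc, ← Finset.sum_add_distrib]
  refine Finset.sum_congr rfl fun j hj => ?_
  have := hS a (Finset.mem_insert_self _ _) j hj
  field_simp
  ring

/-- The product `∏_{i ∈ S, j ∈ R} (i - t j) / (i - j)`. -/
def amp (t : ℂ) (S R : Finset ℂ) : ℂ := ∏ i ∈ S, psi t i R

/-- The part of the column-removal expansion of `pdwSet` that involves the `y`-variables. -/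
def colSum (t : ℂ) (S T : Finset ℂ) : ℂ :=
  phi t (T.card - S.card) * ∑ T' ∈ T.powersetCard S.card,
    amp t T' (T \ T') * (∏ i ∈ T', i) * pdwSet t S T'

theorem amp_insert_left (t : ℂ) {p : ℂ} {S : Finset ℂ} (R : Finset ℂ) (h : p ∉ S) :
    amp t (insert p S) R = psi t p R * amp t S R :=
  Finset.prod_insert h

theorem amp_insert_right (t : ℂ) {p : ℂ} (S : Finset ℂ) {R : Finset ℂ} (h : p ∉ R) :
    amp t S (insert p R) = (∏ i ∈ S, psi t i {p}) * amp t S R := by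
  rw [amp, amp, ← Finset.prod_mul_distrib]
  refine Finset.prod_congr rfl fun i _ => ?_
  rw [psi_insert t i h, show psi t i {p} = _ from Finset.prod_singleton _ _]

theorem psi_mul_psi_sdiff (t p : ℂ) {S T : Finset ℂ} (h : S ⊆ T) :
    psi t p S * psi t p (T \ S) = psi t p T := by
  rw [mul_comm]
  exact Finset.prod_sdiff h

theorem kern_mul_kern_sdiff (t y : ℂ) {S T : Finset ℂ} (h : S ⊆ T) :
    kern t S y * kern t (T \ S) y = kern t T y := by
  rw [mul_comm]
  exact Finset.prod_sdiff h

theorem sdiff_insert_eq_erase_sdiff (S U : Finset ℂ) (p : ℂ) :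
    S \ insert p U = S.erase p \ U := by
  ext i
  simp only [Finset.mem_sdiff, Finset.mem_insert, Finset.mem_erase]
  tauto

theorem sdiff_eq_insert_erase_sdiff {S U : Finset ℂ} {p : ℂ} (hp : p ∈ S)
    (hU : U ⊆ S.erase p) : S \ U = insert p (S.erase p \ U) := by
  have : p ∉ U := fun h => by simpa using hU h
  ext i
  simp only [Finset.mem_sdiff, Finset.mem_insert, Finset.mem_erase]
  by_cases hi : i = p
  · subst hi; tauto
  · tauto

theorem notMem_of_subset_erase {S U : Finset ℂ} {p : ℂ} (hU : U ⊆ S.erase p) : p ∉ U :=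
  fun h => by simpa using hU h

theorem sum_powerset_sum_mem (S : Finset ℂ) (F : Finset ℂ → ℂ → ℂ) :
    ∑ U ∈ S.powerset, ∑ p ∈ U, F U p =
      ∑ p ∈ S, ∑ U ∈ (S.erase p).powerset, F (insert p U) p := by
  rw [Finset.sum_comm' (t' := S) (s' := fun p => S.powerset.filter (p ∈ ·))
    (by intro U p; simp only [Finset.mem_powerset, Finset.mem_filter]
        exact ⟨fun h => ⟨h, h.1 h.2⟩, fun h => h.1⟩)]
  refine Finset.sum_congr rfl fun p hp => ?_
  refine Finset.sum_bij' (fun U _ => U.erase p) (fun U _ => insert p U) ?_ ?_ ?_ ?_ ?_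
  · intro U hU
    simp only [Finset.mem_filter, Finset.mem_powerset] at hU ⊢
    exact Finset.erase_subset_erase _ hU.1
  · intro U hU
    simp only [Finset.mem_filter, Finset.mem_powerset] at hU ⊢
    exact ⟨Finset.insert_subset hp (hU.trans (Finset.erase_subset _ _)),
      Finset.mem_insert_self _ _⟩
  · intro U hU
    exact Finset.insert_erase (Finset.mem_filter.1 hU).2
  · intro U hU
    exact Finset.erase_insert (notMem_of_subset_erase (Finset.mem_powerset.1 hU))
  · intro U hU
    rw [Finset.insert_erase (Finset.mem_filter.1 hU).2]

theorem sum_powersetCard_sum_mem (S : Finset ℂ) (k : ℕ) (F : Finset ℂ → ℂ → ℂ) :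
    ∑ U ∈ S.powersetCard (k + 1), ∑ p ∈ U, F U p =
      ∑ p ∈ S, ∑ U ∈ (S.erase p).powersetCard k, F (insert p U) p := by
  have h := sum_powerset_sum_mem S fun U p => if U.card = k + 1 then F U p else 0
  simp only [Finset.powersetCard_eq_filter, Finset.sum_filter]
  refine Eq.trans (Finset.sum_congr rfl fun U _ => ?_) (h.trans
    (Finset.sum_congr rfl fun p _ => Finset.sum_congr rfl fun U hU => ?_))
  · split_ifs <;> simp
  · rw [Finset.card_insert_of_notMem (notMem_of_subset_erase (Finset.mem_powerset.1 hU))]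
    simp

theorem sum_powerset_sum_sdiff (S : Finset ℂ) (F : Finset ℂ → ℂ → ℂ) :
    ∑ U ∈ S.powerset, ∑ p ∈ S \ U, F U p =
      ∑ p ∈ S, ∑ U ∈ (S.erase p).powerset, F U p := by
  refine Finset.sum_comm' fun U p => ?_
  simp only [Finset.mem_powerset, Finset.mem_sdiff, Finset.subset_erase]
  tauto

theorem colSum_insert (t : ℂ) {a : ℂ} {S T : Finset ℂ} (ha : a ∉ S)
    (hS : ∀ x ∈ insert a S, ∀ y ∈ T, 1 - x * y ≠ 0) :
    colSum t (insert a S) T = ∑ j ∈ T, (1 - t) * j / (1 - a * j) * kern t S j *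
      psi t j (T.erase j) * colSum t S (T.erase j) := by
  have h1 : ∑ T' ∈ T.powersetCard (S.card + 1),
        amp t T' (T \ T') * (∏ i ∈ T', i) * pdwSet t (insert a S) T' =
      ∑ T' ∈ T.powersetCard (S.card + 1), ∑ j ∈ T', amp t T' (T \ T') * (∏ i ∈ T', i) *
        ((1 - t) / (1 - a * j) * kern t S j *
      psi t j (T'.erase j) * pdwSet t S (T'.erase j)) := by
    refine Finset.sum_congr rfl fun T' hT' => ?_
    rw [pdwSet_insert t ha fun x hx y hy =>
      hS x hx y ((Finset.mem_powersetCard.1 hT').1 hy), Finset.mul_sum]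
  rw [colSum, Finset.card_insert_of_notMem ha, h1, sum_powersetCard_sum_mem, Finset.mul_sum]
  refine Finset.sum_congr rfl fun j hj => ?_
  rw [colSum, Finset.card_erase_of_mem hj, Nat.sub_sub, add_comm 1, Finset.mul_sum,
    Finset.mul_sum, Finset.mul_sum]
  refine Finset.sum_congr rfl fun U hU => ?_
  have hU' := (Finset.mem_powersetCard.1 hU).1
  have hjU := notMem_of_subset_erase hU'
  rw [sdiff_insert_eq_erase_sdiff, amp_insert_left t _ hjU, Finset.prod_insert hjU,
    Finset.erase_insert hjU, ← psi_mul_psi_sdiff t j hU']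
  ring

set_option maxHeartbeats 1000000 in
/-- The poles at `a ∈ S` cancel in the column-removal expansion of `pdwSet`. -/
theorem sum_column_cancel (t : ℂ) {a : ℂ} {S T : Finset ℂ} (ha : a ∉ S)
    (hS : ∀ x ∈ insert a S, ∀ y ∈ T, 1 - x * y ≠ 0) :
    ∑ U ∈ S.powerset, amp t U (S \ U) * (∏ i ∈ U, i) * colSum t U T *
        (∏ i ∈ U, psi t i {a} - 1) =
      - ∑ U ∈ S.powerset, ∑ j ∈ T, amp t U (S \ U) * (a * ∏ i ∈ U, i) *
        ((1 - t) * j / (1 - a * j) * kern t U j * psi t j (T.erase j) *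
          colSum t U (T.erase j)) * (psi t a (S \ U) - kern t (S \ U) j) := by
  have hS' : ∀ x ∈ S, ∀ y ∈ T, 1 - x * y ≠ 0 :=
    fun x hx => hS x (Finset.mem_insert_of_mem hx)
  have l1 : ∑ U ∈ S.powerset, amp t U (S \ U) * (∏ i ∈ U, i) * colSum t U T *
      (∏ i ∈ U, psi t i {a} - 1) = ∑ U ∈ S.powerset, ∑ p ∈ U,
      amp t U (S \ U) * (∏ i ∈ U, i) * colSum t U T *
      ((1 - t) * a / (p - a) * ∏ i ∈ U.erase p, psi t i {p}) :=
    Finset.sum_congr rfl fun U hU => by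
      rw [prod_div_sub_one t a U fun h => ha (Finset.mem_powerset.1 hU h), Finset.mul_sum]
  have l2 : ∑ U ∈ S.powerset, ∑ j ∈ T, amp t U (S \ U) * (a * ∏ i ∈ U, i) *
      ((1 - t) * j / (1 - a * j) * kern t U j * psi t j (T.erase j) *
        colSum t U (T.erase j)) * (psi t a (S \ U) - kern t (S \ U) j) =
      ∑ U ∈ S.powerset, ∑ p ∈ S \ U, ∑ j ∈ T, amp t U (S \ U) * (a * ∏ i ∈ U, i) *
      ((1 - t) * j / (1 - a * j) * kern t U j * psi t j (T.erase j) *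
        colSum t U (T.erase j)) * ((1 - t) * p * (1 - a * j) / ((a - p) * (1 - p * j)) *
          psi t p ((S \ U).erase p)) :=
    Finset.sum_congr rfl fun U hU => by
      rw [Finset.sum_comm]
      refine Finset.sum_congr rfl fun j hj => ?_
      rw [psi_sub_kern t a j (S \ U) (fun h => ha (Finset.mem_sdiff.1 h).1)
        fun i hi => hS' i (Finset.mem_sdiff.1 hi).1 j hj, Finset.mul_sum]
  rw [l1, l2, sum_powerset_sum_mem, sum_powerset_sum_sdiff, ← Finset.sum_neg_distrib]
  refine Finset.sum_congr rfl fun p hp => ?_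
  rw [← Finset.sum_neg_distrib]
  refine Finset.sum_congr rfl fun U hU => ?_
  have hU' := Finset.mem_powerset.1 hU
  have hpU := notMem_of_subset_erase hU'
  have hpR : p ∉ S.erase p \ U := by simp
  rw [sdiff_insert_eq_erase_sdiff, sdiff_eq_insert_erase_sdiff hp hU',
    amp_insert_left t _ hpU, amp_insert_right t _ hpR, Finset.erase_insert hpU,
    Finset.erase_insert hpR, Finset.prod_insert hpU,
    colSum_insert t hpU (fun x hx => hS' x (Finset.insert_subset hp
      (hU'.trans (Finset.erase_subset _ _)) hx)), Finset.mul_sum, Finset.sum_mul,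
    ← Finset.sum_neg_distrib]
  refine Finset.sum_congr rfl fun j hj => ?_
  have e1 := hS a (Finset.mem_insert_self _ _) j hj
  have e2 := hS' p hp j hj
  have e3 : a - p ≠ 0 := fun e => ha (by rwa [sub_eq_zero.1 e])
  rw [show p - a = -(a - p) by ring]
  have e1' : 1 - j * a ≠ 0 := by rwa [mul_comm]
  have e2' : 1 - j * p ≠ 0 := by rwa [mul_comm]
  generalize psi t p (S.erase p \ U) = c1, amp t U (S.erase p \ U) = c2, ∏ i ∈ U, i = c3,
    ∏ i ∈ U, psi t i {p} = c4, kern t U j = c5, psi t j (T.erase j) = c6,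
    colSum t U (T.erase j) = c7
  field_simp

theorem pdwSet_column_expansion (t : ℂ) (S T : Finset ℂ)
    (hS : ∀ x ∈ S, ∀ y ∈ T, 1 - x * y ≠ 0) (hc : S.card ≤ T.card) :
    pdwSet t S T = ∑ U ∈ S.powerset, amp t U (S \ U) * (∏ i ∈ U, i) * colSum t U T := by
  induction S using Finset.induction_on generalizing T with
  | empty => simp [pdwSet_empty, amp, colSum, phi]
  | insert a S ha ih =>
    rw [Finset.card_insert_of_notMem ha] at hc
    have hS' : ∀ x ∈ S, ∀ y ∈ T, 1 - x * y ≠ 0 :=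
      fun x hx => hS x (Finset.mem_insert_of_mem hx)
    have hSj : ∀ j ∈ T, pdwSet t S (T.erase j) =
        ∑ U ∈ S.powerset, amp t U (S \ U) * (∏ i ∈ U, i) * colSum t U (T.erase j) :=
      fun j hj => ih (T.erase j) (fun x hx y hy => hS' x hx y (Finset.mem_of_mem_erase hy))
        (by rw [Finset.card_erase_of_mem hj]; omega)
    have hU0 : ∀ U ∈ S.powerset, amp t U (insert a S \ U) =
        (∏ i ∈ U, psi t i {a}) * amp t U (S \ U) := fun U hU => by
      have hU' := Finset.mem_powerset.1 hU
      rw [sdiff_eq_insert_erase_sdiff (Finset.mem_insert_self a S)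
        (by rwa [Finset.erase_insert ha]), Finset.erase_insert ha,
        amp_insert_right t U fun h => ha (Finset.mem_sdiff.1 h).1]
    have hU1 : ∀ U ∈ S.powerset, amp t (insert a U) (insert a S \ insert a U) *
        (∏ i ∈ insert a U, i) * colSum t (insert a U) T = ∑ j ∈ T,
        psi t a (S \ U) * amp t U (S \ U) * (a * ∏ i ∈ U, i) * ((1 - t) * j / (1 - a * j) *
          kern t U j * psi t j (T.erase j) * colSum t U (T.erase j)) := fun U hU => by
      have hU' := Finset.mem_powerset.1 hU
      have haU : a ∉ U := fun h => ha (hU' h)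
      rw [sdiff_insert_eq_erase_sdiff, Finset.erase_insert ha, amp_insert_left t _ haU,
        Finset.prod_insert haU, colSum_insert t haU fun x hx =>
          hS x (Finset.insert_subset_insert a hU' hx), Finset.mul_sum]
    have main := sum_column_cancel t ha hS
    rw [pdwSet_insert' t ha hS (by omega), Finset.sum_powerset_insert ha,
      Finset.sum_congr rfl hU1, ih T hS' (by omega)]
    have r1 : ∑ U ∈ S.powerset, amp t U (insert a S \ U) * (∏ i ∈ U, i) * colSum t U T =
        ∑ U ∈ S.powerset, amp t U (S \ U) * (∏ i ∈ U, i) * colSum t U T +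
        ∑ U ∈ S.powerset, amp t U (S \ U) * (∏ i ∈ U, i) * colSum t U T *
          (∏ i ∈ U, psi t i {a} - 1) := by
      rw [← Finset.sum_add_distrib]
      refine Finset.sum_congr rfl fun U hU => ?_
      rw [hU0 U hU]
      ring
    have r2 : ∑ j ∈ T, a * j * (1 - t) / (1 - a * j) * kern t S j * psi t j (T.erase j) *
          pdwSet t S (T.erase j) = ∑ U ∈ S.powerset, ∑ j ∈ T, amp t U (S \ U) *
          (a * ∏ i ∈ U, i) * ((1 - t) * j / (1 - a * j) * kern t U j * psi t j (T.erase j) *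
            colSum t U (T.erase j)) * kern t (S \ U) j := by
      rw [Finset.sum_comm]
      refine Finset.sum_congr rfl fun j hj => ?_
      rw [hSj j hj, Finset.mul_sum]
      refine Finset.sum_congr rfl fun U hU => ?_
      rw [← kern_mul_kern_sdiff t j (Finset.mem_powerset.1 hU)]
      ring
    rw [r1, r2, main, add_assoc]
    congr 1
    rw [neg_add_eq_sub, ← Finset.sum_sub_distrib]
    refine Finset.sum_congr rfl fun U _ => ?_
    rw [← Finset.sum_sub_distrib]
    refine Finset.sum_congr rfl fun j _ => ?_
    ring

theorem sum_prod_erase_eq {ι : Type*} [Fintype ι] [DecidableEq ι] (z f : ι → ℂ)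
    (hf : ∀ j, f j ≠ 0) :
    ∑ j, z j * ∏ k ∈ Finset.univ.erase j, f k = (∏ k, f k) * ∑ j, z j / f j := by
  rw [Finset.mul_sum]
  refine Finset.sum_congr rfl fun j _ => ?_
  rw [← Finset.mul_prod_erase _ _ (Finset.mem_univ j)]
  field_simp [hf j]

open Polynomial in
/-- Vanishing power sums `∑ z_j y_j ^ k` lower the degree of the numerator of
`∑ z_j / ((X - y_j) (X - t y_j))`. -/
theorem degree_sum_prod_erase_lt {ι : Type*} [Fintype ι] [DecidableEq ι] {t : ℂ} (ht : t ≠ 1)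
    (y z : ι → ℂ) (d : ℕ) (hb : ∀ k < d, ∑ j, z j * y j ^ k = 0) {M : ℕ}
    (hM : M + d + 1 = 2 * Fintype.card ι) :
    (∑ j, C (z j) * ∏ k ∈ Finset.univ.erase j, ((X - C (y k)) * (X - C (t * y k)))).degree
      < M := by
  set W : ι → ℂ[X] := fun j =>
    ∏ k ∈ Finset.univ.erase j, ((X - C (y k)) * (X - C (t * y k))) with hW
  have hWall : ∀ j, ((X - C (y j)) * (X - C (t * y j))) * W j =
      ∏ k, ((X - C (y k)) * (X - C (t * y k))) := fun j =>
    Finset.mul_prod_erase _ _ (Finset.mem_univ j)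
  have key : ∀ e ≤ d, ∑ j, C (z j * y j ^ e) * W j *
      (C (1 - t ^ (e + 1)) * X - C (t * (1 - t ^ e) * y j)) =
      C (1 - t) * X ^ (e + 1) * ∑ j, C (z j) * W j := by
    intro e he
    induction e with
    | zero =>
      rw [Finset.mul_sum]
      refine Finset.sum_congr rfl fun j _ => ?_
      simp
      ring
    | succ e ih =>
      have h0 : ∑ j, C (z j * y j ^ e) * (((X - C (y j)) * (X - C (t * y j))) * W j) = 0 := by
        simp only [hWall]
        rw [← Finset.sum_mul, ← map_sum, hb e (by omega), map_zero, zero_mul]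
      have h1 : C (1 - t) * X ^ (e + 1 + 1) * ∑ j, C (z j) * W j =
          X * (C (1 - t) * X ^ (e + 1) * ∑ j, C (z j) * W j) - C (1 - t ^ (e + 1)) *
          ∑ j, C (z j * y j ^ e) * (((X - C (y j)) * (X - C (t * y j))) * W j) := by
        rw [h0]
        ring
      rw [h1, ← ih (by omega), Finset.mul_sum, Finset.mul_sum, ← Finset.sum_sub_distrib]
      refine Finset.sum_congr rfl fun j _ => ?_
      simp only [map_mul, map_pow, map_sub, map_one]
      ring
  have hWdeg : ∀ j, (W j).natDegree ≤ 2 * (Fintype.card ι - 1) := fun j => by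
    refine (natDegree_prod_le _ _).trans ((Finset.sum_le_card_nsmul _ _ 2 fun k _ => ?_).trans ?_)
    · exact (natDegree_mul_le).trans (by rw [natDegree_X_sub_C, natDegree_X_sub_C])
    · rw [Finset.card_erase_of_mem (Finset.mem_univ j), Finset.card_univ, smul_eq_mul, mul_comm]
  set Q := ∑ j, C (z j) * W j with hQ
  by_cases hQ0 : Q = 0
  · rw [hQ0, degree_zero]
    exact WithBot.bot_lt_coe _
  rw [degree_lt_iff_coeff_zero]
  intro r hr
  have h2 : (C (1 - t) * X ^ (d + 1) * Q).coeff (r + (d + 1)) = 0 := by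
    rw [← key d le_rfl, finsetSum_coeff]
    refine Finset.sum_eq_zero fun j _ => coeff_eq_zero_of_natDegree_lt ?_
    have hc : 0 < Fintype.card ι := Fintype.card_pos_iff.2 ⟨j⟩
    have e1 : (C (z j * y j ^ d) * W j).natDegree ≤ 2 * (Fintype.card ι - 1) :=
      (natDegree_C_mul_le _ _).trans (hWdeg j)
    have e2 : (C (1 - t ^ (d + 1)) * X - C (t * (1 - t ^ d) * y j)).natDegree ≤ 1 := by
      compute_degree
    have e3 := natDegree_mul_le_of_le e1 e2
    omega
  rw [mul_assoc, coeff_C_mul, coeff_X_pow_mul] at h2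
  exact (mul_eq_zero.1 h2).resolve_left (sub_ne_zero.2 ht.symm)

open Polynomial in
/-- The interpolation identity behind the expansion of the determinant along its first row. -/
theorem prod_mul_sum_eq_of_sum_eq_zero {ι : Type*} [Fintype ι] [DecidableEq ι] {t : ℂ}
    (ht : t ≠ 1) (y z : ι → ℂ) (hy : Function.Injective y) (S : Finset ℂ) (d : ℕ)
    (hcard : Fintype.card ι = S.card + 1 + d) {a : ℂ} (ha0 : a ≠ 0) (hS0 : ∀ x ∈ S, x ≠ 0)
    (ha1 : ∀ j, 1 - a * y j ≠ 0) (ha2 : ∀ j, 1 - t * (a * y j) ≠ 0)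
    (hS1 : ∀ x ∈ S, ∀ j, 1 - x * y j ≠ 0) (hS2 : ∀ x ∈ S, ∀ j, 1 - t * (x * y j) ≠ 0)
    (h1 : ∀ x ∈ S, ∑ j, z j / ((1 - x * y j) * (1 - t * (x * y j))) = 0)
    (h2 : ∀ k < d, ∑ j, z j * y j ^ k = 0) :
    (∏ j, (1 - t * (a * y j))) * ∑ j, z j / ((1 - a * y j) * (1 - t * (a * y j))) =
      a ^ d * (∏ x ∈ S, (a - x)) * ∑ j, z j * (∏ k ∈ Finset.univ.erase j, (y j - t * y k)) /
        ((1 - a * y j) * ∏ x ∈ S, (1 - x * y j)) := by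
  set P : ℂ[X] := ∑ j, C (z j) *
    ∏ k ∈ Finset.univ.erase j, ((X - C (y k)) * (X - C (t * y k))) with hP
  set c : ι → ℂ := fun j => (∏ k ∈ Finset.univ.erase j, (y j - t * y k)) /
    ∏ x ∈ S, (1 - x * y j) with hc
  set R : ℂ[X] := (∏ x ∈ S, (1 - C x * X)) *
    ∑ j, C (z j * c j) * ∏ k ∈ Finset.univ.erase j, (X - C (y k)) with hR
  have hPe : ∀ u, P.eval u = ∑ j, z j *
      ∏ k ∈ Finset.univ.erase j, ((u - y k) * (u - t * y k)) := fun u => by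
    simp [hP, eval_finsetSum, eval_prod]
  have hRe : ∀ u, R.eval u = (∏ x ∈ S, (1 - x * u)) * ∑ j, z j * c j *
      ∏ k ∈ Finset.univ.erase j, (u - y k) := fun u => by
    simp [hR, eval_finsetSum, eval_prod]
  have hSprod : ∀ j, ∏ x ∈ S, (1 - x * y j) ≠ 0 := fun j =>
    Finset.prod_ne_zero_iff.2 fun x hx => hS1 x hx j
  have hscale : ∀ x : ℂ, x ≠ 0 → x ^ (2 * (Fintype.card ι - 1)) * P.eval x⁻¹ =
      ∑ j, z j * ∏ k ∈ Finset.univ.erase j, ((1 - x * y k) * (1 - t * (x * y k))) := by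
    intro x hx
    rw [hPe, Finset.mul_sum]
    refine Finset.sum_congr rfl fun j _ => ?_
    have : x ^ (2 * (Fintype.card ι - 1)) = ∏ k ∈ Finset.univ.erase j, x ^ 2 := by
      rw [Finset.prod_const, Finset.card_erase_of_mem (Finset.mem_univ j), Finset.card_univ,
        pow_mul]
    rw [this, mul_left_comm, ← Finset.prod_mul_distrib]
    congr 1
    refine Finset.prod_congr rfl fun k _ => ?_
    field_simp
  set N : Finset ℂ := Finset.univ.image y ∪ S.image (·⁻¹) with hN
  have hdisj : Disjoint (Finset.univ.image y) (S.image (·⁻¹)) := by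
    rw [Finset.disjoint_left]
    intro u hu hu'
    obtain ⟨j, -, rfl⟩ := Finset.mem_image.1 hu
    obtain ⟨x, hx, hxy⟩ := Finset.mem_image.1 hu'
    apply hS1 x hx j
    rw [← hxy, mul_inv_cancel₀ (hS0 x hx), sub_self]
  have hNc : N.card = Fintype.card ι + S.card := by
    rw [hN, Finset.card_union_of_disjoint hdisj, Finset.card_image_of_injective _ hy,
      Finset.card_image_of_injective _ inv_injective, Finset.card_univ]
  have hPR : P = R := by
    refine eq_of_degrees_lt_of_eval_finset_eq N ?_ ?_ fun u hu => ?_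
    · exact degree_sum_prod_erase_lt ht y z d h2 (by omega)
    · rw [hNc]
      have e1 : (∏ x ∈ S, (1 - C x * X)).natDegree ≤ S.card := by
        refine (natDegree_prod_le _ _).trans
          ((Finset.sum_le_card_nsmul _ _ 1 fun x _ => ?_).trans (by simp))
        compute_degree
      have e2 : (∑ j, C (z j * c j) * ∏ k ∈ Finset.univ.erase j, (X - C (y k))).natDegree ≤
          Fintype.card ι - 1 := by
        refine natDegree_sum_le_of_forall_le _ _ fun j _ => (natDegree_C_mul_le _ _).trans ?_
        refine (natDegree_prod_le _ _).trans
          ((Finset.sum_le_card_nsmul _ _ 1 fun x _ => ?_).trans ?_)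
        · rw [natDegree_X_sub_C]
        · simp [Finset.card_erase_of_mem]
      have e3 := natDegree_mul_le_of_le e1 e2
      rw [← hR] at e3
      refine lt_of_le_of_lt degree_le_natDegree ?_
      norm_cast
      omega
    · rcases Finset.mem_union.1 hu with hu | hu
      · obtain ⟨l, -, rfl⟩ := Finset.mem_image.1 hu
        have hz : ∀ j, j ≠ l → ∏ k ∈ Finset.univ.erase j, (y l - y k) = 0 := fun j hj =>
          Finset.prod_eq_zero (Finset.mem_erase.2 ⟨hj.symm, Finset.mem_univ l⟩) (sub_self _)
        rw [hPe, hRe, Finset.sum_eq_single l, Finset.sum_eq_single l,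
          Finset.prod_mul_distrib, hc]
        · have := hSprod l
          dsimp only
          generalize ∏ x ∈ S, (1 - x * y l) = e at this ⊢
          field_simp
        · intro j _ hj
          rw [hz j hj, mul_zero]
        · simp
        · intro j _ hj
          rw [Finset.prod_mul_distrib, hz j hj, zero_mul, mul_zero]
        · simp
      · obtain ⟨x, hx, rfl⟩ := Finset.mem_image.1 hu
        have hx0 := hS0 x hx
        rw [hRe, Finset.prod_eq_zero hx (by rw [mul_inv_cancel₀ hx0, sub_self]), zero_mul]
        have := hscale x hx0
        rw [sum_prod_erase_eq z _ fun j => mul_ne_zero (hS1 x hx j) (hS2 x hx j), h1 x hx,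
          mul_zero] at this
        exact (mul_eq_zero.1 this).resolve_left (pow_ne_zero _ hx0)
  have hA := hscale a ha0
  rw [sum_prod_erase_eq z _ fun j => mul_ne_zero (ha1 j) (ha2 j), Finset.prod_mul_distrib,
    hPR, hRe] at hA
  have hB : a ^ (2 * (Fintype.card ι - 1)) * ((∏ x ∈ S, (1 - x * a⁻¹)) * ∑ j, z j * c j *
      ∏ k ∈ Finset.univ.erase j, (a⁻¹ - y k)) = a ^ d * (∏ x ∈ S, (a - x)) *
      ((∏ j, (1 - a * y j)) * ∑ j, z j * c j / (1 - a * y j)) := by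
    have hpow : a ^ (2 * (Fintype.card ι - 1)) =
        a ^ d * (∏ x ∈ S, a) * a ^ (Fintype.card ι - 1) := by
      rw [Finset.prod_const, ← pow_add, ← pow_add]
      congr 1
      omega
    rw [hpow, show ∀ p q r u v : ℂ, p * q * r * (u * v) = p * (q * u) * (r * v) from
      fun _ _ _ _ _ => by ring, ← Finset.prod_mul_distrib,
      ← sum_prod_erase_eq (fun j => z j * c j) _ ha1, Finset.mul_sum]
    congr 1
    · congr 1
      refine Finset.prod_congr rfl fun x _ => ?_
      field_simp
    · refine Finset.sum_congr rfl fun j _ => ?_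
      have : a ^ (Fintype.card ι - 1) = ∏ k ∈ Finset.univ.erase j, a := by
        rw [Finset.prod_const, Finset.card_erase_of_mem (Finset.mem_univ j), Finset.card_univ]
      rw [this, mul_left_comm, ← Finset.prod_mul_distrib]
      congr 1
      refine Finset.prod_congr rfl fun k _ => ?_
      field_simp
  have hne : ∏ j, (1 - a * y j) ≠ 0 := Finset.prod_ne_zero_iff.2 fun j _ => ha1 j
  refine mul_left_cancel₀ hne ?_
  rw [← mul_assoc, ← hA, hB]
  rw [mul_left_comm]
  congr 2
  refine Finset.sum_congr rfl fun j _ => ?_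
  have h3 := hSprod j
  have h4 := ha1 j
  rw [hc]
  dsimp only
  have h5 : 1 - y j * a ≠ 0 := by rwa [mul_comm]
  generalize ∏ x ∈ S, (1 - x * y j) = e at h3 ⊢
  field_simp

/-- The matrix whose determinant is the partial domain wall partition function. -/
def dwMatrix (t : ℂ) {m n : ℕ} (x : Fin m → ℂ) (y : Fin n → ℂ) : Matrix (Fin n) (Fin n) ℂ :=
  Matrix.of fun i j =>
    if h : (i : ℕ) < m then
      (1 - t) / ((1 - x ⟨(i : ℕ), h⟩ * y j) * (1 - t * (x ⟨(i : ℕ), h⟩ * y j)))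
    else y j ^ (n - 1 - (i : ℕ))

theorem vprod_succ {n : ℕ} (y : Fin (n + 1) → ℂ) :
    vprod y = (∏ i : Fin n, (y 0 - y i.succ)) * vprod (Fin.tail y) := by
  simp only [vprod, Fin.prod_univ_succ, Fin.prod_Ioi_zero, Fin.prod_Ioi_succ, Fin.tail]

theorem vprod_succAbove {n : ℕ} (y : Fin (n + 1) → ℂ) (j : Fin (n + 1)) :
    vprod y = (-1) ^ (j : ℕ) * (∏ k ∈ Finset.univ.erase j, (y j - y k)) *
      vprod (y ∘ j.succAbove) := by
  have hp : ∀ {n : ℕ} (y : Fin (n + 1) → ℂ) (j : Fin (n + 1)),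
      ∏ k ∈ Finset.univ.erase j, (y j - y k) = ∏ k : Fin n, (y j - y (j.succAbove k)) :=
    fun y j => by
      rw [← Finset.compl_singleton, ← Fin.image_succAbove_univ,
        Finset.prod_image fun a _ b _ h => Fin.succAbove_right_injective h]
  rw [hp]
  induction n with
  | zero =>
    obtain rfl : j = 0 := Fin.fin_one_eq_zero j
    simp [vprod]
  | succ n ih =>
    induction j using Fin.cases with
    | zero =>
      rw [vprod_succ]
      simp only [Fin.val_zero, pow_zero, one_mul, Fin.succAbove_zero]
      rfl
    | succ j =>
      have ht : Fin.tail (y ∘ j.succ.succAbove) = Fin.tail y ∘ j.succAbove := by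
        ext k
        simp [Fin.tail]
      rw [vprod_succ y, ih (Fin.tail y) j, vprod_succ (y ∘ j.succ.succAbove),
        Fin.prod_univ_succ (fun k => y j.succ - y (j.succ.succAbove k)),
        Fin.prod_univ_succAbove _ j, ht]
      simp only [Function.comp_def, Fin.succ_succAbove_zero, Fin.succ_succAbove_succ,
        Fin.tail, Fin.val_succ, pow_succ]
      ring

theorem dwMatrix_det_zero (t : ℂ) {n : ℕ} (x : Fin 0 → ℂ) (y : Fin n → ℂ) :
    (dwMatrix t x y).det = vprod y := by
  have : dwMatrix t x y = (Matrix.projVandermonde (fun _ => 1) y).transpose := by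
    ext i j
    simp only [dwMatrix, Matrix.of_apply, Matrix.transpose_apply, Matrix.projVandermonde_apply,
      Fin.val_rev]
    simp
    congr 1
    omega
  rw [this, Matrix.det_transpose, Matrix.det_projVandermonde]
  simp [vprod]

theorem dwMatrix_submatrix (t : ℂ) {m n : ℕ} (x : Fin (m + 1) → ℂ) (y : Fin (n + 1) → ℂ)
    (j : Fin (n + 1)) :
    (dwMatrix t x y).submatrix Fin.succ j.succAbove =
      dwMatrix t (Fin.tail x) (y ∘ j.succAbove) := by
  ext i k
  simp only [dwMatrix, Matrix.submatrix_apply, Matrix.of_apply, Fin.val_succ,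
    add_lt_add_iff_right, Function.comp_apply, Fin.tail, Fin.succ_mk,
    show n + 1 - 1 - ((i : ℕ) + 1) = n - 1 - i by omega]

/-- Expanding along the first row a matrix whose first row repeats a later one gives zero. -/
theorem sum_cofactor_mul_row_eq_zero {n : ℕ} (A : Matrix (Fin (n + 1)) (Fin (n + 1)) ℂ)
    (i : Fin n) :
    ∑ j : Fin (n + 1), (-1) ^ (j : ℕ) * (A.submatrix Fin.succ j.succAbove).det * A i.succ j
      = 0 := by
  have h := Matrix.det_zero_of_row_eq (M := A.updateRow 0 (A i.succ)) (Fin.succ_ne_zero i).symm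
    (by rw [Matrix.updateRow_self, Matrix.updateRow_ne (Fin.succ_ne_zero i)])
  rw [Matrix.det_succ_row_zero] at h
  rw [← h]
  refine Finset.sum_congr rfl fun j _ => ?_
  rw [Matrix.updateRow_self, mul_right_comm]
  have : (A.updateRow 0 (A i.succ)).submatrix Fin.succ j.succAbove =
      A.submatrix Fin.succ j.succAbove := by
    ext a b
    rw [Matrix.submatrix_apply, Matrix.submatrix_apply, Matrix.updateRow_ne (Fin.succ_ne_zero a)]
  rw [this]

theorem dwMatrix_det {t : ℂ} (ht : t ≠ 1) {m n : ℕ} (hmn : m ≤ n) (x : Fin m → ℂ)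
    (y : Fin n → ℂ) (hx : Function.Injective x) (hy : Function.Injective y)
    (hx0 : ∀ i, x i ≠ 0) (h1 : ∀ i j, 1 - x i * y j ≠ 0)
    (h2 : ∀ i j, 1 - t * (x i * y j) ≠ 0) :
    phi t (n - m) * (∏ i, ∏ j, (1 - t * (x i * y j))) * (dwMatrix t x y).det =
      (∏ i, x i ^ (n - m)) * vprod x * vprod y * pdw t (List.ofFn x) (Finset.univ.image y) := by
  induction m generalizing n with
  | zero =>
    rw [dwMatrix_det_zero]
    simp [pdw, vprod, Finset.card_image_of_injective _ hy]
    ring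
  | succ m ih =>
    obtain ⟨n, rfl⟩ : ∃ k, n = k + 1 := ⟨n - 1, by omega⟩
    have hmn' : m ≤ n := by omega
    have hd : n + 1 - (m + 1) = n - m := by omega
    rw [hd]
    set z : Fin (n + 1) → ℂ := fun j =>
      (-1) ^ (j : ℕ) * (dwMatrix t (Fin.tail x) (y ∘ j.succAbove)).det with hz
    have hrow : ∀ i : Fin n, ∑ j, z j * dwMatrix t x y i.succ j = 0 := fun i => by
      have := sum_cofactor_mul_row_eq_zero (dwMatrix t x y) i
      simpa only [dwMatrix_submatrix] using this
    have hdet : (dwMatrix t x y).det =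
        (1 - t) * ∑ j, z j / ((1 - x 0 * y j) * (1 - t * (x 0 * y j))) := by
      rw [Matrix.det_succ_row_zero, Finset.mul_sum]
      refine Finset.sum_congr rfl fun j _ => ?_
      rw [dwMatrix_submatrix, hz]
      simp [dwMatrix]
      ring
    have hxt : Function.Injective (Fin.tail x) := hx.comp (Fin.succ_injective _)
    have key := prod_mul_sum_eq_of_sum_eq_zero ht y z hy (Finset.univ.image (Fin.tail x)) (n - m)
      (by rw [Finset.card_image_of_injective _ hxt]; simp; omega) (hx0 0)
      (by simp only [Finset.mem_image]; rintro _ ⟨i, -, rfl⟩; exact hx0 _) (h1 0) (h2 0)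
      (by simp only [Finset.mem_image]; rintro _ ⟨i, -, rfl⟩; exact h1 _)
      (by simp only [Finset.mem_image]; rintro _ ⟨i, -, rfl⟩; exact h2 _)
      (by
        simp only [Finset.mem_image]
        rintro _ ⟨i, -, rfl⟩
        have := hrow ⟨i, by omega⟩
        simp only [dwMatrix, Matrix.of_apply, Fin.val_succ, add_lt_add_iff_right, i.2,
          dif_pos] at this
        refine (mul_eq_zero.1 ?_).resolve_left (sub_ne_zero.2 ht.symm)
        rw [Finset.mul_sum, ← this]
        refine Finset.sum_congr rfl fun j _ => ?_
        rw [mul_div_left_comm]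
        rfl)
      (by
        intro k hk
        have := hrow ⟨n - 1 - k, by omega⟩
        simp only [dwMatrix, Matrix.of_apply, Fin.val_succ, add_lt_add_iff_right,
          show ¬ (n - 1 - k < m) by omega, dif_neg, not_false_eq_true,
          show n + 1 - 1 - (n - 1 - k + 1) = k by omega] at this
        exact this)
    simp only [Finset.prod_image hxt.injOn] at key
    have hih : ∀ j, phi t (n - m) * (∏ i, ∏ k ∈ Finset.univ.erase j,
        (1 - t * (Fin.tail x i * y k))) * (dwMatrix t (Fin.tail x) (y ∘ j.succAbove)).det =
      (∏ i, Fin.tail x i ^ (n - m)) * vprod (Fin.tail x) * vprod (y ∘ j.succAbove) *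
        pdw t (List.ofFn (Fin.tail x)) ((Finset.univ.image y).erase (y j)) := fun j => by
      have hys : Function.Injective (y ∘ j.succAbove) := hy.comp Fin.succAbove_right_injective
      have := ih hmn' (Fin.tail x) (y ∘ j.succAbove) hxt hys (fun i => hx0 _)
        (fun i k => h1 _ _) (fun i k => h2 _ _)
      have e1 : Finset.univ.image (y ∘ j.succAbove) = (Finset.univ.image y).erase (y j) := by
        rw [← Finset.image_image, Fin.image_succAbove_univ, Finset.compl_singleton,
          Finset.image_erase hy]
      have e2 : ∀ f : Fin (n + 1) → ℂ, ∏ k ∈ Finset.univ.erase j, f k =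
          ∏ k, f (j.succAbove k) := fun f => by
        rw [← Finset.compl_singleton, ← Fin.image_succAbove_univ,
          Finset.prod_image fun a _ b _ h => Fin.succAbove_right_injective h]
      simp only [e2, ← e1]
      exact this
    have hpdw : pdw t (List.ofFn x) (Finset.univ.image y) = ∑ j, (1 - t) / (1 - x 0 * y j) *
        (∏ i, (1 - t * Fin.tail x i * y j) / (1 - Fin.tail x i * y j)) *
        (∏ k ∈ Finset.univ.erase j, (y j - t * y k) / (y j - y k)) *
        pdw t (List.ofFn (Fin.tail x)) ((Finset.univ.image y).erase (y j)) := by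
      rw [List.ofFn_succ, pdw, Finset.sum_image hy.injOn]
      refine Finset.sum_congr rfl fun j _ => ?_
      rw [List.map_ofFn, List.prod_ofFn, psi, ← Finset.image_erase hy, Finset.prod_image hy.injOn]
      rfl
    rw [hdet, hpdw, Fin.prod_univ_succ (fun i => ∏ j, (1 - t * (x i * y j))),
      Fin.prod_univ_succ (fun i => x i ^ (n - m)), vprod_succ x]
    have re : ∀ p q r s u : ℂ, p * (q * r) * (s * u) = p * r * s * (q * u) :=
      fun _ _ _ _ _ => by ring
    rw [re, key, Finset.mul_sum, Finset.mul_sum, Finset.mul_sum]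
    refine Finset.sum_congr rfl fun j _ => ?_
    have h3 := hih j
    have h4 : ∏ i : Fin m, ∏ k, (1 - t * (x i.succ * y k)) =
        (∏ i, (1 - t * (Fin.tail x i * y j))) *
          ∏ i, ∏ k ∈ Finset.univ.erase j, (1 - t * (Fin.tail x i * y k)) := by
      rw [← Finset.prod_mul_distrib]
      exact Finset.prod_congr rfl fun i _ => (Finset.mul_prod_erase _ _ (Finset.mem_univ j)).symm
    have h5 := vprod_succAbove y j
    have h6 : ∏ k ∈ Finset.univ.erase j, (y j - y k) ≠ 0 :=
      Finset.prod_ne_zero_iff.2 fun k hk =>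
        sub_ne_zero.2 fun e => (Finset.mem_erase.1 hk).1 (hy e).symm
    have h7 : ∏ i, (1 - Fin.tail x i * y j) ≠ 0 :=
      Finset.prod_ne_zero_iff.2 fun i _ => h1 _ _
    have h8 : ∏ i, (1 - t * Fin.tail x i * y j) = ∏ i, (1 - t * (Fin.tail x i * y j)) := by
      simp only [mul_assoc]
    rw [h4, h5, Finset.prod_div_distrib, Finset.prod_div_distrib, h8, hz]
    generalize ∏ i, (1 - Fin.tail x i * y j) = a1 at h7 ⊢
    generalize ∏ k ∈ Finset.univ.erase j, (y j - y k) = a2 at h6 ⊢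
    generalize ∏ k ∈ Finset.univ.erase j, (y j - t * y k) = a3
    have h9 := h1 0 j
    generalize 1 - x 0 * y j = a4 at h9 ⊢
    have h10 : ∏ i : Fin m, x i.succ ^ (n - m) = ∏ i, Fin.tail x i ^ (n - m) := rfl
    have h11 : ∏ i : Fin m, (x 0 - x i.succ) = ∏ i, (x 0 - Fin.tail x i) := rfl
    rw [h10, h11]
    have fin : ∀ P B A Xd Dl XD D Vs V' pd sg : ℂ, P * B * D = XD * V' * Vs * pd →
        P * (A * B) * (1 - t) * (Xd * Dl * (sg * D * a3 / (a4 * a1))) =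
        Xd * XD * (Dl * V') * (sg * a2 * Vs) * ((1 - t) / a4 * (A / a1) * (a3 / a2) * pd) := by
      intro P B A Xd Dl XD D Vs V' pd sg h
      field_simp
      linear_combination (Xd * Dl * A * a3 * sg) * h
    have h12 := fin _ _ (∏ i, (1 - t * (Fin.tail x i * y j))) (x 0 ^ (n - m))
      (∏ i, (x 0 - Fin.tail x i)) _ _ _ _ _ ((-1) ^ (j : ℕ)) h3
    linear_combination h12

/-- The symmetrization in the definition of the Hall–Littlewood polynomial, computed by choosing
the variables one at a time. -/
def hlSum (t : ℂ) : List ℕ → Finset ℂ → ℂ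
  | [], _ => 1
  | a :: l, S => ∑ p ∈ S, p ^ a * psi t p (S.erase p) * hlSum t l (S.erase p)

/-- The `t`-factorial `∏_{j=1}^k (1 - t^j) / (1 - t)`. -/
def tfact (t : ℂ) (k : ℕ) : ℂ := ∏ j ∈ Finset.range k, ((1 - t ^ (j + 1)) / (1 - t))

/-- The product of the `t`-factorials of the multiplicities of the entries of a list. -/
def multFact (t : ℂ) (l : List ℕ) : ℂ := ∏ i ∈ l.toFinset, tfact t (l.count i)

/-- A list of natural numbers padded with zeros to length `n`. -/
def padZero (n : ℕ) (l : List ℕ) : List ℕ := l ++ List.replicate (n - l.length) 0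

theorem tfact_zero (t : ℂ) : tfact t 0 = 1 := rfl

theorem tfact_succ (t : ℂ) (k : ℕ) :
    tfact t (k + 1) = tfact t k * ((1 - t ^ (k + 1)) / (1 - t)) :=
  Finset.prod_range_succ _ _

theorem pow_mul_tfact {t : ℂ} (ht : t ≠ 1) (k : ℕ) : (1 - t) ^ k * tfact t k = phi t k := by
  induction k with
  | zero => simp [tfact, phi]
  | succ k ih =>
    have : 1 - t ≠ 0 := sub_ne_zero.2 ht.symm
    rw [tfact_succ, phi_succ, ← ih]
    field_simp
    ring

theorem one_sub_pow_ne_zero {t : ℂ} (ht : ‖t‖ < 1) (k : ℕ) : 1 - t ^ (k + 1) ≠ 0 := by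
  intro h
  have := congrArg norm (sub_eq_zero.1 h)
  rw [norm_one, norm_pow] at this
  exact (pow_lt_one₀ (norm_nonneg t) ht k.succ_ne_zero).ne this.symm

theorem ne_one_of_norm_lt_one {t : ℂ} (ht : ‖t‖ < 1) : t ≠ 1 := by
  rintro rfl
  simp at ht

theorem tfact_ne_zero {t : ℂ} (ht : ‖t‖ < 1) (k : ℕ) : tfact t k ≠ 0 :=
  Finset.prod_ne_zero_iff.2 fun j _ => div_ne_zero (one_sub_pow_ne_zero ht j)
    (sub_ne_zero.2 (ne_one_of_norm_lt_one ht).symm)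

theorem multFact_eq_prod (t : ℂ) {l : List ℕ} {s : Finset ℕ} (h : l.toFinset ⊆ s) :
    multFact t l = ∏ i ∈ s, tfact t (l.count i) :=
  Finset.prod_subset h fun i _ hi => by
    rw [List.count_eq_zero.2 fun h => hi (List.mem_toFinset.2 h), tfact_zero]

theorem multFact_ne_zero {t : ℂ} (ht : ‖t‖ < 1) (l : List ℕ) : multFact t l ≠ 0 :=
  Finset.prod_ne_zero_iff.2 fun _ _ => tfact_ne_zero ht _

theorem multFact_map_add (t : ℂ) (l : List ℕ) (c : ℕ) :
    multFact t (l.map (· + c)) = multFact t l := by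
  have : (l.map (· + c)).toFinset = l.toFinset.image (· + c) := by
    ext; simp
  rw [multFact, this, Finset.prod_image (add_left_injective c).injOn]
  refine Finset.prod_congr rfl fun i _ => ?_
  rw [List.count_map_of_injective _ _ (add_left_injective c)]

theorem multFact_append_replicate_zero (t : ℂ) {l : List ℕ} (h : 0 ∉ l) (r : ℕ) :
    multFact t (l ++ List.replicate r 0) = multFact t l * tfact t r := by
  have hs : (l ++ List.replicate r 0).toFinset ⊆ insert 0 l.toFinset := by
    intro i
    simp only [List.mem_toFinset, List.mem_append, List.mem_replicate, Finset.mem_insert]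
    tauto
  rw [multFact_eq_prod t hs, Finset.prod_insert (by simpa using h), mul_comm, multFact,
    List.count_append, List.count_eq_zero.2 h, List.count_replicate_self, zero_add]
  congr 1
  refine Finset.prod_congr rfl fun i hi => ?_
  have : i ≠ 0 := by
    rintro rfl
    exact h (List.mem_toFinset.1 hi)
  rw [List.count_append, List.count_replicate, if_neg (by simpa using this.symm), add_zero]

theorem hlSum_replicate_zero {t : ℂ} (ht : t ≠ 1) {r : ℕ} {S : Finset ℂ} (hS : S.card = r) :
    hlSum t (List.replicate r 0) S = tfact t r := by
  induction r generalizing S with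
  | zero => rfl
  | succ r ih =>
    rw [List.replicate_succ, hlSum]
    have h : ∀ p ∈ S, p ^ 0 * psi t p (S.erase p) * hlSum t (List.replicate r 0) (S.erase p) =
        psi t p (S.erase p) * tfact t r := fun p hp => by
      rw [ih (by rw [Finset.card_erase_of_mem hp, hS]; rfl), pow_zero, one_mul]
    have h1 := sum_psi_erase t S
    have h2 : 1 - t ≠ 0 := sub_ne_zero.2 ht.symm
    rw [Finset.sum_congr rfl h, ← Finset.sum_mul, tfact_succ, mul_comm]
    congr 1
    rw [eq_div_iff h2, mul_comm, h1, hS]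

theorem hlSum_map_add (t : ℂ) {l : List ℕ} (c : ℕ) {S : Finset ℂ} (hS : S.card = l.length) :
    hlSum t (l.map (· + c)) S = (∏ i ∈ S, i) ^ c * hlSum t l S := by
  induction l generalizing S with
  | nil =>
    rw [List.length_nil, Finset.card_eq_zero] at hS
    simp [hS, hlSum]
  | cons a l ih =>
    rw [List.map_cons, hlSum, hlSum, Finset.mul_sum]
    refine Finset.sum_congr rfl fun p hp => ?_
    rw [ih (by rw [Finset.card_erase_of_mem hp, hS]; rfl), ← Finset.mul_prod_erase S _ hp]
    ring

theorem hlSum_append_replicate (t : ℂ) (l : List ℕ) (r : ℕ) (S : Finset ℂ) :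
    hlSum t (l ++ List.replicate r 0) S = ∑ T ∈ S.powersetCard l.length,
      amp t T (S \ T) * hlSum t l T * hlSum t (List.replicate r 0) (S \ T) := by
  induction l generalizing S with
  | nil => simp [amp, hlSum]
  | cons a l ih =>
    have h : ∀ T ∈ S.powersetCard (l.length + 1),
        amp t T (S \ T) * hlSum t (a :: l) T * hlSum t (List.replicate r 0) (S \ T) =
        ∑ p ∈ T, amp t T (S \ T) * (p ^ a * psi t p (T.erase p) * hlSum t l (T.erase p)) *
          hlSum t (List.replicate r 0) (S \ T) := fun T _ => by
      rw [hlSum, Finset.mul_sum, Finset.sum_mul]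
    rw [List.length_cons, Finset.sum_congr rfl h, sum_powersetCard_sum_mem, List.cons_append,
      hlSum]
    refine Finset.sum_congr rfl fun p hp => ?_
    rw [ih, Finset.mul_sum]
    refine Finset.sum_congr rfl fun U hU => ?_
    have hU' := (Finset.mem_powersetCard.1 hU).1
    have hpU := notMem_of_subset_erase hU'
    rw [sdiff_insert_eq_erase_sdiff, amp_insert_left t _ hpU, Finset.erase_insert hpU,
      ← psi_mul_psi_sdiff t p hU']
    ring

/-- Removing the first column of a Hall–Littlewood polynomial. -/
theorem hlSum_map_succ_padZero {t : ℂ} (ht : t ≠ 1) (l : List ℕ) {S : Finset ℂ} :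
    hlSum t (padZero S.card (l.map (· + 1))) S = tfact t (S.card - l.length) *
      ∑ T ∈ S.powersetCard l.length, amp t T (S \ T) * (∏ i ∈ T, i) * hlSum t l T := by
  rw [padZero, hlSum_append_replicate, List.length_map, Finset.mul_sum]
  refine Finset.sum_congr rfl fun T hT => ?_
  obtain ⟨hT, hTc⟩ := Finset.mem_powersetCard.1 hT
  rw [hlSum_map_add t 1 hTc, hlSum_replicate_zero ht (by rw [Finset.card_sdiff_of_subset hT, hTc])]
  ring

theorem sum_perm_eq_hlSum (t : ℂ) {n : ℕ} (l : Fin n → ℕ) {x : Fin n → ℂ}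
    (hx : Function.Injective x) :
    ∑ σ : Equiv.Perm (Fin n), (∏ i : Fin n, x (σ i) ^ l i) *
        ∏ i : Fin n, ∏ j ∈ Finset.Ioi i, (x (σ i) - t * x (σ j)) / (x (σ i) - x (σ j)) =
      hlSum t (List.ofFn l) (Finset.univ.image x) := by
  induction n with
  | zero => simp [hlSum]
  | succ n ih =>
    rw [← Equiv.Perm.decomposeFin.symm.sum_comp, Fintype.sum_prod_type, List.ofFn_succ, hlSum,
      Finset.sum_image hx.injOn]
    refine Finset.sum_congr rfl fun p _ => ?_
    set x' : Fin n → ℂ := fun i => x (Equiv.swap 0 p i.succ) with hx'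
    have hinj : Function.Injective x' :=
      hx.comp ((Equiv.injective _).comp (Fin.succ_injective n))
    have himg : Finset.univ.image x' = (Finset.univ.image x).erase (x p) := by
      have h1 : (Finset.univ : Finset (Fin n)).image Fin.succ = Finset.univ.erase 0 := by
        ext i
        simp
      have : Finset.univ.image x' =
          ((Finset.univ.image Fin.succ).image (Equiv.swap 0 p)).image x := by
        rw [Finset.image_image, Finset.image_image]
        rfl
      rw [this, h1, Finset.image_erase (Equiv.injective _), Finset.image_erase hx,
        Equiv.swap_apply_left, Finset.image_univ_equiv]
    rw [← himg, ← ih (fun i => l i.succ) hinj, Finset.mul_sum]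
    refine Finset.sum_congr rfl fun e _ => ?_
    have hpsi : psi t (x p) (Finset.univ.image x') =
        ∏ j, (x p - t * x' (e j)) / (x p - x' (e j)) := by
      rw [psi, Finset.prod_image hinj.injOn,
        Equiv.prod_comp e fun j => (x p - t * x' j) / (x p - x' j)]
    rw [hpsi]
    simp only [Fin.prod_univ_succ, Fin.prod_Ioi_zero, Fin.prod_Ioi_succ,
      Equiv.Perm.decomposeFin_symm_apply_zero, Equiv.Perm.decomposeFin_symm_apply_succ, hx']
    ring

theorem count_ofFn {n : ℕ} (l : Fin n → ℕ) (i : ℕ) : (List.ofFn l).count i = mult l i := by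
  have h := Fin.card_filter_univ_eq_vector_get_eq_count i (List.Vector.ofFn l)
  rw [List.Vector.toList_ofFn] at h
  rw [← h, mult]
  simp [eq_comm]

theorem vlam_eq_multFact {n : ℕ} (l : Fin n → ℕ) (t : ℂ) :
    vlam l t = multFact t (List.ofFn l) := by
  have hs : (List.ofFn l).toFinset ⊆ Finset.range (Finset.univ.sup l + 1) := by
    intro i hi
    obtain ⟨j, rfl⟩ := List.mem_ofFn.1 (List.mem_toFinset.1 hi)
    exact Finset.mem_range.2 (Nat.lt_succ_of_le (Finset.le_sup (Finset.mem_univ j)))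
  rw [multFact_eq_prod t hs]
  simp only [count_ofFn]
  rfl

theorem hallLittlewood_eq_hlSum {n : ℕ} (l : Fin n → ℕ) {x : Fin n → ℂ}
    (hx : Function.Injective x) (t : ℂ) :
    hallLittlewood l x t =
      (multFact t (List.ofFn l))⁻¹ * hlSum t (List.ofFn l) (Finset.univ.image x) := by
  rw [hallLittlewood, sum_perm_eq_hlSum t l hx, vlam_eq_multFact]

theorem ofFn_pad_eq_padZero {m n : ℕ} (hmn : m ≤ n) (l : Fin m → ℕ) :
    (List.ofFn fun j : Fin n => if h : (j : ℕ) < m then l ⟨(j : ℕ), h⟩ else 0) =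
      padZero n (List.ofFn l) := by
  refine List.ext_getElem ?_ fun i h1 h2 => ?_
  · simp [padZero]
    omega
  · rw [List.getElem_ofFn]
    simp only [padZero, List.getElem_append, List.length_ofFn, List.getElem_ofFn,
      List.getElem_replicate]

theorem phi_mul_bfac {t : ℂ} (ht : t ≠ 1) {m n : ℕ} (hmn : m ≤ n) (l : Fin m → ℕ) :
    phi t (n - len l) * bfac l t = (1 - t) ^ n * multFact t (padZero n (List.ofFn l)) := by
  have hlen : mult l 0 + len l = m := by
    have := Finset.card_filter_add_card_filter_not (s := (Finset.univ : Finset (Fin m)))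
      (fun k => l k = 0)
    simpa [mult, len] using this
  have hrange : Finset.range (Finset.univ.sup l + 1) =
      insert 0 (Finset.Icc 1 (Finset.univ.sup l)) := by
    ext i
    simp only [Finset.mem_range, Finset.mem_insert, Finset.mem_Icc]
    omega
  have h0 : (0 : ℕ) ∉ Finset.Icc 1 (Finset.univ.sup l) := by simp
  have hsum : ∑ i ∈ Finset.Icc 1 (Finset.univ.sup l), mult l i = len l := by
    have h := Finset.card_eq_sum_card_fiberwise (f := l) (s := Finset.univ)
      (t := Finset.range (Finset.univ.sup l + 1)) fun j _ =>
        Finset.mem_coe.2 (Finset.mem_range.2 (Nat.lt_succ_of_le (Finset.le_sup (Finset.mem_univ j))))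
    rw [hrange, Finset.sum_insert h0, Finset.card_univ, Fintype.card_fin] at h
    have h' : m = mult l 0 + ∑ i ∈ Finset.Icc 1 (Finset.univ.sup l), mult l i := h
    omega
  have hs : (padZero n (List.ofFn l)).toFinset ⊆
      insert 0 (Finset.Icc 1 (Finset.univ.sup l)) := by
    rw [← hrange]
    intro i hi
    rw [List.mem_toFinset, padZero, List.mem_append] at hi
    rcases hi with hi | hi
    · obtain ⟨j, rfl⟩ := List.mem_ofFn.1 hi
      exact Finset.mem_range.2 (Nat.lt_succ_of_le (Finset.le_sup (Finset.mem_univ j)))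
    · rw [List.eq_of_mem_replicate hi]
      simp
  have hc0 : (padZero n (List.ofFn l)).count 0 = n - len l := by
    rw [padZero, List.count_append, List.count_replicate_self, count_ofFn, List.length_ofFn]
    omega
  have hc : ∀ i ∈ Finset.Icc 1 (Finset.univ.sup l),
      (padZero n (List.ofFn l)).count i = mult l i := fun i hi => by
    have : (0 : ℕ) ≠ i := by
      have := (Finset.mem_Icc.1 hi).1
      omega
    rw [padZero, List.count_append, List.count_replicate, if_neg (by simpa using this),
      count_ofFn, add_zero]
  have hpow : (1 - t) ^ n = (1 - t) ^ (n - len l) *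
      ∏ i ∈ Finset.Icc 1 (Finset.univ.sup l), (1 - t) ^ mult l i := by
    rw [Finset.prod_pow_eq_pow_sum, hsum, ← pow_add]
    congr 1
    omega
  rw [multFact_eq_prod t hs, Finset.prod_insert h0, hc0, hpow, mul_mul_mul_comm,
    pow_mul_tfact ht, ← Finset.prod_mul_distrib, bfac]
  congr 1
  refine Finset.prod_congr rfl fun i hi => ?_
  rw [hc i hi, pow_mul_tfact ht, phi]

/-- The summand of the Cauchy-type sum for a partition with at most `l.length` parts. -/
def hlTerm (t : ℂ) (l : List ℕ) (S T : Finset ℂ) : ℂ :=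
  (1 - t) ^ T.card * (multFact t (padZero S.card l))⁻¹ * hlSum t (padZero S.card l) S *
    hlSum t (padZero T.card l) T

/-- The terms of the column-removal expansion of `pdwSet` for columns of length at most `k`. -/
def colPart (t : ℂ) (k : ℕ) (S T : Finset ℂ) : ℂ :=
  ∑ i ∈ Finset.range (k + 1), ∑ U ∈ S.powersetCard i,
    amp t U (S \ U) * (∏ i ∈ U, i) * colSum t U T

theorem padZero_of_length_eq {n : ℕ} {l : List ℕ} (h : l.length = n) : padZero n l = l := by
  simp [padZero, h]

theorem padZero_append_zero {n : ℕ} {l : List ℕ} (h : l.length < n) :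
    padZero n (l ++ [0]) = padZero n l := by
  rw [padZero, padZero, List.append_assoc, List.singleton_append, ← List.replicate_succ,
    List.length_append, List.length_singleton, show n - (l.length + 1) + 1 = n - l.length by omega]

theorem hlTerm_nil {t : ℂ} (ht : ‖t‖ < 1) (S T : Finset ℂ) : hlTerm t [] S T = phi t T.card := by
  have ht1 := ne_one_of_norm_lt_one ht
  have h : multFact t (List.replicate S.card 0) = tfact t S.card := by
    have := multFact_append_replicate_zero t (l := []) (by simp) S.card
    simpa [multFact] using this
  simp only [hlTerm, padZero, List.nil_append, List.length_nil, Nat.sub_zero]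
  rw [h, hlSum_replicate_zero ht1 rfl, hlSum_replicate_zero ht1 rfl, mul_assoc ((1 - t) ^ _),
    inv_mul_cancel₀ (tfact_ne_zero ht _), mul_one, pow_mul_tfact ht1]

theorem hlTerm_append_zero (t : ℂ) {l : List ℕ} {S T : Finset ℂ} (h : l.length < S.card)
    (hST : S.card ≤ T.card) : hlTerm t (l ++ [0]) S T = hlTerm t l S T := by
  rw [hlTerm, hlTerm, padZero_append_zero h, padZero_append_zero (h.trans_le hST)]

theorem hlTerm_map_add (t : ℂ) {l : List ℕ} {S T : Finset ℂ} (c : ℕ) (hS : S.card = l.length)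
    (hT : T.card = l.length) :
    hlTerm t (l.map (· + c)) S T = hlTerm t l S T * ((∏ i ∈ S, i) * ∏ i ∈ T, i) ^ c := by
  have h1 : (l.map (· + c)).length = S.card := by rw [List.length_map, hS]
  have h2 : (l.map (· + c)).length = T.card := by rw [List.length_map, hT]
  rw [hlTerm, hlTerm, padZero_of_length_eq h1, padZero_of_length_eq h2,
    padZero_of_length_eq hS.symm, padZero_of_length_eq hT.symm, multFact_map_add,
    hlSum_map_add t c hS, hlSum_map_add t c hT]
  ring

theorem hlTerm_map_succ {t : ℂ} (ht : ‖t‖ < 1) {l : List ℕ} {S T : Finset ℂ}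
    (hT : l.length ≤ T.card) :
    hlTerm t (l.map (· + 1)) S T = ∑ U ∈ S.powersetCard l.length,
      amp t U (S \ U) * (∏ i ∈ U, i) * (phi t (T.card - l.length) *
        ∑ V ∈ T.powersetCard l.length, amp t V (T \ V) * (∏ i ∈ V, i) * hlTerm t l U V) := by
  have ht1 := ne_one_of_norm_lt_one ht
  have hmul : multFact t (padZero S.card (l.map (· + 1))) =
      multFact t l * tfact t (S.card - l.length) := by
    rw [padZero, multFact_append_replicate_zero t (by simp), multFact_map_add, List.length_map]
  have hterm : ∀ U ∈ S.powersetCard l.length, ∀ V ∈ T.powersetCard l.length,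
      hlTerm t l U V = (1 - t) ^ l.length * (multFact t l)⁻¹ * hlSum t l U * hlSum t l V :=
    fun U hU V hV => by
      have hU' := (Finset.mem_powersetCard.1 hU).2
      have hV' := (Finset.mem_powersetCard.1 hV).2
      rw [hlTerm, padZero_of_length_eq hU'.symm, padZero_of_length_eq hV'.symm, hV']
  have hphi : (1 - t) ^ T.card * tfact t (T.card - l.length) =
      (1 - t) ^ l.length * phi t (T.card - l.length) := by
    rw [← pow_mul_tfact ht1, ← mul_assoc, ← pow_add]
    congr 2
    omega
  have hne := tfact_ne_zero ht (S.card - l.length)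
  have hne' := multFact_ne_zero ht l
  rw [hlTerm, hmul, hlSum_map_succ_padZero ht1, hlSum_map_succ_padZero ht1]
  have re : ∀ p f g a b A B : ℂ, f ≠ 0 → g ≠ 0 → p * (f * g)⁻¹ * (g * A) * (a * B) =
      p * a * f⁻¹ * A * B := fun p f g a b A B hf hg => by field_simp
  rw [re _ _ _ _ 0 _ _ hne' hne, hphi, mul_assoc _ (∑ _ ∈ _, _), Finset.sum_mul, Finset.mul_sum]
  refine Finset.sum_congr rfl fun U hU => ?_
  rw [Finset.mul_sum, Finset.mul_sum, Finset.mul_sum, Finset.mul_sum]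
  refine Finset.sum_congr rfl fun V hV => ?_
  rw [hterm U hU V hV]
  ring

/-- Appending a zero part to a partition. -/
def snocZero {k : ℕ} (l : {l : Fin k → ℕ // Antitone l}) : {l : Fin (k + 1) → ℕ // Antitone l} :=
  ⟨Fin.snoc (α := fun _ => ℕ) l.1 0, fun i j hij => by
    induction j using Fin.lastCases with
    | last => simp
    | cast j =>
      induction i using Fin.lastCases with
      | last => exact absurd hij (by simp [Fin.le_def])
      | cast i => simpa using l.2 (by simpa using hij)⟩

/-- Adding `c` to every part of a partition. -/
def shiftParts {k : ℕ} (c : ℕ) (l : {l : Fin k → ℕ // Antitone l}) :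
    {l : Fin k → ℕ // Antitone l} :=
  ⟨fun i => l.1 i + c, fun _ _ hij => Nat.add_le_add_right (l.2 hij) c⟩

theorem ofFn_snocZero {k : ℕ} (l : {l : Fin k → ℕ // Antitone l}) :
    List.ofFn (snocZero l).1 = List.ofFn l.1 ++ [0] := by
  rw [List.ofFn_succ_last]
  simp [snocZero]

theorem ofFn_shiftParts {k : ℕ} (c : ℕ) (l : {l : Fin k → ℕ // Antitone l}) :
    List.ofFn (shiftParts c l).1 = (List.ofFn l.1).map (· + c) := by
  rw [List.map_ofFn]
  rfl

/-- A partition into `k + 1` parts is a partition into `k` parts, shifted by its last part. -/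
def shiftEquiv (k : ℕ) :
    {l : Fin k → ℕ // Antitone l} × ℕ ≃ {l : Fin (k + 1) → ℕ // Antitone l} where
  toFun p := shiftParts p.2 (snocZero p.1)
  invFun l := (⟨fun i => l.1 i.castSucc - l.1 (Fin.last k), fun _ _ hij =>
    Nat.sub_le_sub_right (l.2 (by simpa using hij)) _⟩, l.1 (Fin.last k))
  left_inv p := by
    ext <;> simp [shiftParts, snocZero]
  right_inv l := by
    ext i
    induction i using Fin.lastCases with
    | last => simp [shiftParts, snocZero]
    | cast i =>
      have := l.2 (Fin.le_last i.castSucc)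
      simp [shiftParts, snocZero, this]

theorem shiftEquiv_apply {k : ℕ} (p : {l : Fin k → ℕ // Antitone l} × ℕ) :
    shiftEquiv k p = shiftParts p.2 (snocZero p.1) := rfl

theorem snocZero_injective (k : ℕ) : Function.Injective (snocZero (k := k)) := fun l l' h => by
  ext i
  have := congrFun (congrArg Subtype.val h) i.castSucc
  simpa [snocZero] using this

theorem shiftParts_injective (k c : ℕ) : Function.Injective (shiftParts (k := k) c) :=
  fun l l' h => by
    ext i
    have := congrFun (congrArg Subtype.val h) i
    simpa [shiftParts] using this

theorem isCompl_range_snocZero (k : ℕ) :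
    IsCompl (Set.range (snocZero (k := k))) (Set.range (shiftParts (k := k + 1) 1)) := by
  have h1 : Set.range (snocZero (k := k)) = {l | l.1 (Fin.last k) = 0} := by
    ext l
    refine ⟨?_, fun h => ⟨⟨fun i => l.1 i.castSucc, fun _ _ hij => l.2 (by simpa using hij)⟩, ?_⟩⟩
    · rintro ⟨l, rfl⟩
      simp [snocZero]
    · ext i
      induction i using Fin.lastCases with
      | last =>
        have h' : l.1 (Fin.last k) = 0 := h
        simp [snocZero, h']
      | cast i => simp [snocZero]
  have h2 : Set.range (shiftParts (k := k + 1) 1) = {l | l.1 (Fin.last k) = 0}ᶜ := by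
    ext l
    refine ⟨?_, fun h => ⟨⟨fun i => l.1 i - 1, fun _ _ hij => Nat.sub_le_sub_right (l.2 hij) _⟩,
      ?_⟩⟩
    · rintro ⟨l, rfl⟩
      simp [shiftParts]
    · ext i
      have h3 : l.1 (Fin.last k) ≠ 0 := h
      have h4 := l.2 (Fin.le_last i)
      change l.1 i - 1 + 1 = l.1 i
      omega
  rw [h1, h2]
  exact isCompl_compl

theorem norm_prod_lt_one {S : Finset ℂ} (hS : S.Nonempty) (h : ∀ x ∈ S, ‖x‖ < 1) :
    ‖∏ x ∈ S, x‖ < 1 := by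
  obtain ⟨a, ha⟩ := hS
  rw [← Finset.mul_prod_erase S _ ha, norm_mul, norm_prod]
  refine mul_lt_one_of_nonneg_of_lt_one_left (norm_nonneg a) (h a ha) ?_
  exact Finset.prod_le_one (fun _ _ => norm_nonneg _)
    fun x hx => (h x (Finset.mem_of_mem_erase hx)).le

theorem hasSum_mul_pow {α : Type*} {f : α → ℂ} {e q : ℂ} (hq : ‖q‖ < 1) (h : HasSum f e) :
    HasSum (fun p : α × ℕ => f p.1 * q ^ p.2) (e * (1 - q)⁻¹) := by
  have hg := hasSum_geometric_of_norm_lt_one hq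
  exact h.mul hg (summable_mul_of_summable_norm h.summable.norm hg.summable.norm)

theorem norm_prod_mul_prod_lt_one {S T : Finset ℂ} (hS : S.Nonempty) (hT : T.Nonempty)
    (hS1 : ∀ x ∈ S, ‖x‖ < 1) (hT1 : ∀ y ∈ T, ‖y‖ < 1) :
    ‖(∏ x ∈ S, x) * ∏ y ∈ T, y‖ < 1 := by
  rw [norm_mul]
  exact mul_lt_one_of_nonneg_of_lt_one_left (norm_nonneg _) (norm_prod_lt_one hS hS1)
    (norm_prod_lt_one hT hT1).le

theorem hlTerm_shiftEquiv (t : ℂ) {k : ℕ} {S T : Finset ℂ} (hS : S.card = k + 1)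
    (hT : T.card = k + 1) (p : {l : Fin k → ℕ // Antitone l} × ℕ) :
    hlTerm t (List.ofFn (shiftEquiv k p).1) S T =
      hlTerm t (List.ofFn p.1.1) S T * ((∏ x ∈ S, x) * ∏ y ∈ T, y) ^ p.2 := by
  rw [shiftEquiv_apply, ofFn_shiftParts,
    hlTerm_map_add t _ (by rw [List.length_ofFn, hS]) (by rw [List.length_ofFn, hT]),
    ofFn_snocZero, hlTerm_append_zero t (by rw [List.length_ofFn]; omega) (by omega)]

theorem hasSum_hlTerm_of_card_eq {t e : ℂ} {k : ℕ} {S T : Finset ℂ} (hS : S.card = k + 1)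
    (hT : T.card = k + 1) (hS1 : ∀ x ∈ S, ‖x‖ < 1) (hT1 : ∀ y ∈ T, ‖y‖ < 1)
    (h : HasSum (fun l : {l : Fin k → ℕ // Antitone l} => hlTerm t (List.ofFn l.1) S T) e) :
    HasSum (fun l : {l : Fin (k + 1) → ℕ // Antitone l} => hlTerm t (List.ofFn l.1) S T)
      (e * (1 - (∏ x ∈ S, x) * ∏ y ∈ T, y)⁻¹) := by
  have hm := hasSum_mul_pow (norm_prod_mul_prod_lt_one (Finset.card_pos.1 (hS ▸ k.succ_pos))
    (Finset.card_pos.1 (hT ▸ k.succ_pos)) hS1 hT1) h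
  refine (shiftEquiv k).hasSum_iff.1 ?_
  rwa [show (fun l : {l : Fin (k + 1) → ℕ // Antitone l} => hlTerm t (List.ofFn l.1) S T) ∘
    shiftEquiv k = _ from funext (hlTerm_shiftEquiv t hS hT)]

theorem hasSum_of_snocZero_of_shiftParts {k : ℕ} {f : {l : Fin (k + 1) → ℕ // Antitone l} → ℂ}
    {a b : ℂ} (ha : HasSum (fun l => f (snocZero l)) a)
    (hb : HasSum (fun l => f (shiftParts 1 l)) b) : HasSum f (a + b) :=
  ((snocZero_injective k).hasSum_range_iff.2 ha).add_isCompl (isCompl_range_snocZero k)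
    ((shiftParts_injective (k + 1) 1).hasSum_range_iff.2 hb)

theorem one_sub_mul_ne_zero {x y : ℂ} (hx : ‖x‖ < 1) (hy : ‖y‖ < 1) : 1 - x * y ≠ 0 := by
  intro h
  have h1 := congrArg norm (sub_eq_zero.1 h)
  rw [norm_one, norm_mul] at h1
  exact (mul_lt_one_of_nonneg_of_lt_one_left (norm_nonneg _) hx hy.le).ne h1.symm

theorem pdwSet_eq_colPart {t : ℂ} {S T : Finset ℂ} (hST : S.card ≤ T.card)
    (h : ∀ x ∈ S, ∀ y ∈ T, 1 - x * y ≠ 0) : pdwSet t S T = colPart t S.card S T := by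
  rw [pdwSet_column_expansion t S T h hST, Finset.sum_powerset, colPart]

theorem colPart_succ (t : ℂ) (k : ℕ) (S T : Finset ℂ) :
    colPart t (k + 1) S T = colPart t k S T + ∑ U ∈ S.powersetCard (k + 1),
      amp t U (S \ U) * (∏ i ∈ U, i) * colSum t U T :=
  Finset.sum_range_succ _ _

theorem pdwSet_eq_colPart_mul {t : ℂ} {k : ℕ} {S T : Finset ℂ} (hS : S.card = k + 1)
    (hT : T.card = k + 1) (hS1 : ∀ x ∈ S, ‖x‖ < 1) (hT1 : ∀ y ∈ T, ‖y‖ < 1) :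
    pdwSet t S T = colPart t k S T * (1 - (∏ x ∈ S, x) * ∏ y ∈ T, y)⁻¹ := by
  have hne : 1 - (∏ x ∈ S, x) * ∏ y ∈ T, y ≠ 0 := one_sub_mul_ne_zero
    (norm_prod_lt_one (Finset.card_pos.1 (by omega)) hS1)
    (norm_prod_lt_one (Finset.card_pos.1 (by omega)) hT1)
  have h := pdwSet_eq_colPart (t := t) (hS.trans hT.symm).le
    fun x hx y hy => one_sub_mul_ne_zero (hS1 x hx) (hT1 y hy)
  rw [hS, colPart_succ, ← hS, Finset.powersetCard_self, Finset.sum_singleton, colSum, hS, hT.symm,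
    Finset.powersetCard_self, Finset.sum_singleton] at h
  rw [eq_mul_inv_iff_mul_eq₀ hne, mul_sub, mul_one, sub_eq_iff_eq_add]
  refine h.trans ?_
  rw [Nat.sub_self]
  simp [amp, psi, phi]
  ring

theorem hasSum_hlTerm {t : ℂ} (ht : ‖t‖ < 1) (k : ℕ) {S T : Finset ℂ} (hk : k ≤ S.card)
    (hST : S.card ≤ T.card) (hS1 : ∀ x ∈ S, ‖x‖ < 1) (hT1 : ∀ y ∈ T, ‖y‖ < 1) :
    HasSum (fun l : {l : Fin k → ℕ // Antitone l} => hlTerm t (List.ofFn l.1) S T)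
      (colPart t k S T) := by
  induction k generalizing S T with
  | zero =>
    have : Unique {l : Fin 0 → ℕ // Antitone l} :=
      ⟨⟨⟨Fin.elim0, fun i => i.elim0⟩⟩, fun l => Subtype.ext (Subsingleton.elim _ _)⟩
    have h := hasSum_unique fun l : {l : Fin 0 → ℕ // Antitone l} => hlTerm t (List.ofFn l.1) S T
    convert h using 1
    simp [hlTerm_nil ht, colPart, amp, colSum, pdwSet_empty, phi]
  | succ k ih =>
    have hsq : ∀ U ∈ S.powersetCard (k + 1), ∀ V ∈ T.powersetCard (k + 1),
        HasSum (fun l : {l : Fin (k + 1) → ℕ // Antitone l} => hlTerm t (List.ofFn l.1) U V)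
          (pdwSet t U V) := fun U hU V hV => by
      obtain ⟨hU, hUc⟩ := Finset.mem_powersetCard.1 hU
      obtain ⟨hV, hVc⟩ := Finset.mem_powersetCard.1 hV
      have hU1 : ∀ x ∈ U, ‖x‖ < 1 := fun x hx => hS1 x (hU hx)
      have hV1 : ∀ x ∈ V, ‖x‖ < 1 := fun x hx => hT1 x (hV hx)
      rw [pdwSet_eq_colPart_mul hUc hVc hU1 hV1]
      exact hasSum_hlTerm_of_card_eq hUc hVc hU1 hV1
        (ih (by omega) (hUc.trans hVc.symm).le hU1 hV1)
    rw [colPart_succ]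
    refine hasSum_of_snocZero_of_shiftParts ?_ ?_
    · have hterm : ∀ l : {l : Fin k → ℕ // Antitone l},
          hlTerm t (List.ofFn (snocZero l).1) S T = hlTerm t (List.ofFn l.1) S T := fun l => by
        rw [ofFn_snocZero, hlTerm_append_zero t (by rwa [List.length_ofFn]) hST]
      simpa only [hterm] using ih (by omega) hST hS1 hT1
    · have hk' : ∀ l : {l : Fin (k + 1) → ℕ // Antitone l}, (List.ofFn l.1).length ≤ T.card :=
        fun l => by rw [List.length_ofFn]; omega
      have hV : ∀ U ∈ S.powersetCard (k + 1),
          HasSum (fun l : {l : Fin (k + 1) → ℕ // Antitone l} =>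
            ∑ V ∈ T.powersetCard (k + 1), amp t V (T \ V) * (∏ i ∈ V, i) *
              hlTerm t (List.ofFn l.1) U V)
            (∑ V ∈ T.powersetCard (k + 1), amp t V (T \ V) * (∏ i ∈ V, i) * pdwSet t U V) :=
        fun U hU => hasSum_sum fun V hV => (hsq U hU V hV).mul_left _
      have hcol : ∀ U ∈ S.powersetCard (k + 1),
          phi t (T.card - (k + 1)) * ∑ V ∈ T.powersetCard (k + 1), amp t V (T \ V) *
            (∏ i ∈ V, i) * pdwSet t U V = colSum t U T := fun U hU => by
        rw [colSum, (Finset.mem_powersetCard.1 hU).2]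
      have h : HasSum (fun l : {l : Fin (k + 1) → ℕ // Antitone l} =>
          ∑ U ∈ S.powersetCard (k + 1), amp t U (S \ U) * (∏ i ∈ U, i) *
            (phi t (T.card - (k + 1)) * ∑ V ∈ T.powersetCard (k + 1), amp t V (T \ V) *
              (∏ i ∈ V, i) * hlTerm t (List.ofFn l.1) U V))
          (∑ U ∈ S.powersetCard (k + 1), amp t U (S \ U) * (∏ i ∈ U, i) * colSum t U T) :=
        hasSum_sum fun U hU => hcol U hU ▸ ((hV U hU).mul_left _).mul_left _
      have hterm : ∀ l : {l : Fin (k + 1) → ℕ // Antitone l},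
          hlTerm t (List.ofFn (shiftParts 1 l).1) S T =
          ∑ U ∈ S.powersetCard (k + 1), amp t U (S \ U) * (∏ i ∈ U, i) *
            (phi t (T.card - (k + 1)) * ∑ V ∈ T.powersetCard (k + 1), amp t V (T \ V) *
              (∏ i ∈ V, i) * hlTerm t (List.ofFn l.1) U V) := fun l => by
        rw [ofFn_shiftParts, hlTerm_map_succ ht (hk' l), List.length_ofFn]
      simp only [← hterm] at h
      exact h

theorem hlTerm_univ_image {t : ℂ} (ht : ‖t‖ < 1) {m n : ℕ} (hmn : m ≤ n) {x : Fin m → ℂ}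
    {y : Fin n → ℂ} (hx : Function.Injective x) (hy : Function.Injective y) (l : Fin m → ℕ) :
    phi t (n - len l) * bfac l t * hallLittlewood l x t *
        hallLittlewood (fun j : Fin n => if h : (j : ℕ) < m then l ⟨(j : ℕ), h⟩ else 0) y t =
      hlTerm t (List.ofFn l) (Finset.univ.image x) (Finset.univ.image y) := by
  have hS : (Finset.univ.image x).card = m := by
    rw [Finset.card_image_of_injective _ hx, Finset.card_univ, Fintype.card_fin]
  have hT : (Finset.univ.image y).card = n := by
    rw [Finset.card_image_of_injective _ hy, Finset.card_univ, Fintype.card_fin]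
  have hne := multFact_ne_zero ht (padZero n (List.ofFn l))
  rw [phi_mul_bfac (ne_one_of_norm_lt_one ht) hmn, hallLittlewood_eq_hlSum l hx,
    hallLittlewood_eq_hlSum _ hy, ofFn_pad_eq_padZero hmn, hlTerm, hS, hT,
    padZero_of_length_eq (List.length_ofFn (f := l))]
  field_simp

theorem pdw_ofFn_eq_pdwSet (t : ℂ) {m : ℕ} {x : Fin m → ℂ} (hx : Function.Injective x)
    {T : Finset ℂ} (h : ∀ i, ∀ y ∈ T, 1 - x i * y ≠ 0) :
    pdw t (List.ofFn x) T = pdwSet t (Finset.univ.image x) T := by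
  refine pdw_perm t ((List.perm_ext_iff_of_nodup (List.nodup_ofFn.2 hx)
    (Finset.nodup_toList _)).2 fun a => ?_) T fun a ha => ?_
  · simp [List.mem_ofFn]
  · obtain ⟨i, rfl⟩ := (List.mem_ofFn' _ _).1 ha
    exact h i

theorem vprod_ne_zero_of_injective {n : ℕ} {x : Fin n → ℂ} (hx : Function.Injective x) :
    vprod x ≠ 0 :=
  Finset.prod_ne_zero_iff.2 fun _ _ => Finset.prod_ne_zero_iff.2 fun _ hj =>
    sub_ne_zero.2 (hx.ne (Finset.mem_Ioi.1 hj).ne)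

/-- **Refined Cauchy identity for the partial domain wall partition function**
(equation (18) of the paper): for `1 ≤ m < n`,
`Σ_λ ∏_{j=1}^{n-ℓ(λ)} (1-t^j) b_λ(t) P_λ(x₁,…,x_m;t) P_λ(y₁,…,yₙ;t)
  = (∏_{i=1}^{n-m} (1-t^i) ∏_{i,j} (1-t xᵢyⱼ)) / (∏ᵢ xᵢ^{n-m} Δ(x)_m Δ(y)ₙ) · det[𝒜°]`,
where `𝒜°_{ij} = (1-t)/((1-xᵢyⱼ)(1-t xᵢyⱼ))` for `i ≤ m` and `𝒜°_{ij} = yⱼ^{n-i}` for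
`i > m`; the sum is over all partitions `λ` with `ℓ(λ) ≤ m`.  It is stated here for
complex values of the variables in a domain of convergence. -/
theorem partial_dwpf_cauchy (m n : ℕ) (hm : 1 ≤ m) (hmn : m < n)
    (x : Fin m → ℂ) (y : Fin n → ℂ) (t : ℂ)
    (hx : ∀ i, ‖x i‖ < 1 / (8 * n)) (hy : ∀ j, ‖y j‖ < 1 / (8 * n)) (ht : ‖t‖ < 1)
    (hx0 : ∀ i, x i ≠ 0)
    (hxinj : Function.Injective x) (hyinj : Function.Injective y) :
    HasSum
      (fun l : {l : Fin m → ℕ // Antitone l} =>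
        (∏ j ∈ Finset.range (n - len l.1), (1 - t ^ (j + 1))) * bfac l.1 t *
          hallLittlewood l.1 x t *
          hallLittlewood (fun j : Fin n => if h : (j : ℕ) < m then l.1 ⟨(j : ℕ), h⟩ else 0) y t)
      ((∏ i ∈ Finset.range (n - m), (1 - t ^ (i + 1))) *
          (∏ i : Fin m, ∏ j : Fin n, (1 - t * (x i * y j))) /
          ((∏ i : Fin m, x i ^ (n - m)) * vprod x * vprod y) *
        (Matrix.of fun i j : Fin n =>
          if h : (i : ℕ) < m then
            (1 - t) / ((1 - x ⟨(i : ℕ), h⟩ * y j) * (1 - t * (x ⟨(i : ℕ), h⟩ * y j)))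
          else y j ^ (n - 1 - (i : ℕ))).det) := by
  have hn : (1 : ℝ) / (8 * n) ≤ 1 := by
    have : (1 : ℝ) ≤ n := by exact_mod_cast hm.trans hmn.le
    rw [div_le_one (by linarith)]
    linarith
  have hx1 : ∀ i, ‖x i‖ < 1 := fun i => (hx i).trans_le hn
  have hy1 : ∀ j, ‖y j‖ < 1 := fun j => (hy j).trans_le hn
  have h1 : ∀ i j, 1 - x i * y j ≠ 0 := fun i j => one_sub_mul_ne_zero (hx1 i) (hy1 j)
  have h2 : ∀ i j, 1 - t * (x i * y j) ≠ 0 := fun i j => one_sub_mul_ne_zero ht (by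
    rw [norm_mul]
    exact mul_lt_one_of_nonneg_of_lt_one_left (norm_nonneg _) (hx1 i) (hy1 j).le)
  have hS1 : ∀ a ∈ Finset.univ.image x, ‖a‖ < 1 := by simpa using hx1
  have hT1 : ∀ b ∈ Finset.univ.image y, ‖b‖ < 1 := by simpa using hy1
  have hS : (Finset.univ.image x).card = m := by
    rw [Finset.card_image_of_injective _ hxinj, Finset.card_univ, Fintype.card_fin]
  have hT : (Finset.univ.image y).card = n := by
    rw [Finset.card_image_of_injective _ hyinj, Finset.card_univ, Fintype.card_fin]
  have hST : (Finset.univ.image x).card ≤ (Finset.univ.image y).card := by rw [hS, hT]; exact hmn.le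
  have hsum := hasSum_hlTerm ht m hS.ge hST hS1 hT1
  have hval : colPart t m (Finset.univ.image x) (Finset.univ.image y) =
      pdw t (List.ofFn x) (Finset.univ.image y) := by
    rw [pdw_ofFn_eq_pdwSet t hxinj fun i b hb => one_sub_mul_ne_zero (hx1 i) (hT1 b hb),
      pdwSet_eq_colPart hST fun a ha b hb => one_sub_mul_ne_zero (hS1 a ha) (hT1 b hb), hS]
  have hne : (∏ i : Fin m, x i ^ (n - m)) * vprod x * vprod y ≠ 0 :=
    mul_ne_zero (mul_ne_zero (Finset.prod_ne_zero_iff.2 fun i _ => pow_ne_zero _ (hx0 i))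
      (vprod_ne_zero_of_injective hxinj)) (vprod_ne_zero_of_injective hyinj)
  have hdet := dwMatrix_det (ne_one_of_norm_lt_one ht) hmn.le x y hxinj hyinj hx0 h1 h2
  rw [hval, ← mul_div_cancel_left₀ (pdw _ _ _) hne, ← hdet, mul_div_right_comm] at hsum
  simp only [← hlTerm_univ_image ht hmn.le hxinj hyinj] at hsum
  exact hsum
end
end

section
/- Let n ≥ 1 and write ȳ_j = 1/y_j. Summing over all sequences of partitions ∅ = λ^{(0)} ≺ λ^{(1)} ≺ ⋯ ≺ λ^{(n)} = ν̄^{(n)} ≻ μ^{(n)} ≻ ν̄^{(n−1)} ≻ μ^{(n−1)} ≻ ⋯ ≻ ν̄^{(1)} ≻ μ^{(1)} ≻ ν̄^{(0)} = ∅ subject to ℓ(ν̄^{(j)}) ≤ j for all 1 ≤ j ≤ n (i.e. over symplectic plane partitions in the n×2n box), one has Σ ∏_{i=1}^{n} (1 − t^{λ^{(n)}_i − i + n + 1}) · ∏_{i=1}^{n} x_i^{|λ^{(i)}|−|λ^{(i−1)}|} y_i^{2|μ^{(i)}|−|ν̄^{(i)}|−|ν̄^{(i−1)}|} = ( ∏_{i=1}^{n}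 (1−t x_i^2) ) / ( Δ(x)_n Δ(y)_n ∏_{1≤i<j≤n} (1−ȳ_i ȳ_j) ) · det[ (1−t) / ((1−x_i y_j)(1−t x_i y_j)(1−x_i ȳ_j)(1−t x_i ȳ_j)) ]_{1≤i,j≤n}. -/
noncomputable section

open scoped BigOperators

/-- `Interlace a b` means `a ≻ b`, i.e. `a₁ ≥ b₁ ≥ a₂ ≥ b₂ ≥ ⋯`. -/
def Interlace {m : ℕ} (a b : Fin m → ℕ) : Prop :=
  (∀ i, b i ≤ a i) ∧ ∀ i : ℕ, ∀ h : i + 1 < m, a ⟨i + 1, h⟩ ≤ b ⟨i, by omega⟩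

/-- The weight `|λ| = Σᵢ λᵢ` of a partition. -/
def wt {m : ℕ} (l : Fin m → ℕ) : ℕ := ∑ i, l i

/-- A symplectic plane partition in the `n × 2n` box: an interlacing sequence
`∅ = λ⁽⁰⁾ ≺ λ⁽¹⁾ ≺ ⋯ ≺ λ⁽ⁿ⁾ = ν̄⁽ⁿ⁾ ≻ μ⁽ⁿ⁾ ≻ ν̄⁽ⁿ⁻¹⁾ ≻ μ⁽ⁿ⁻¹⁾ ≻ ⋯ ≻ ν̄⁽¹⁾ ≻ μ⁽¹⁾ ≻ ν̄⁽⁰⁾ = ∅`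
with `ℓ(ν̄⁽ʲ⁾) ≤ j`.  Here `p.1 k = λ⁽ᵏ⁾`, `p.2.1 k = μ⁽ᵏ⁺¹⁾` and `p.2.2 k = ν̄⁽ᵏ⁾`. -/
def SympPP (n : ℕ) : Type :=
  {p : (Fin (n + 1) → Fin n → ℕ) × (Fin n → Fin n → ℕ) × (Fin (n + 1) → Fin n → ℕ) //
    (∀ k, Antitone (p.1 k)) ∧ (∀ k, Antitone (p.2.1 k)) ∧ (∀ k, Antitone (p.2.2 k)) ∧
    p.1 0 = (fun _ => 0) ∧ p.2.2 0 = (fun _ => 0) ∧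
    p.1 (Fin.last n) = p.2.2 (Fin.last n) ∧
    (∀ k : Fin n, Interlace (p.1 k.succ) (p.1 k.castSucc)) ∧
    (∀ k : Fin n, Interlace (p.2.2 k.succ) (p.2.1 k)) ∧
    (∀ k : Fin n, Interlace (p.2.1 k) (p.2.2 k.castSucc)) ∧
    (∀ k : Fin (n + 1), ∀ i : Fin n, (k : ℕ) ≤ (i : ℕ) → p.2.2 k i = 0)}

/-- A finite sequence extended by zeros. -/
def padded {m : ℕ} (a : Fin m → ℕ) (i : ℕ) : ℕ := if h : i < m then a ⟨i, h⟩ else 0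

/-- The alternant `det (u i (a j + k - 1 - j))` of size `k`. -/
def alternant (u : ℕ → ℕ → ℂ) (k : ℕ) (a : ℕ → ℕ) : ℂ :=
  (Matrix.of fun i j : Fin k => u i (a j + (k - 1 - j))).det

/-- The sequences of length `k` interlacing with `a`. -/
def interlaceBox (k : ℕ) (a : ℕ → ℕ) : Finset (Fin k → ℕ) :=
  Fintype.piFinset fun j : Fin k => Finset.Icc (a (j + 1)) (a j)

lemma det_eq_of_forall_col_eq_smul_add_succ {R : Type*} [CommRing R] {n : ℕ}
    {A B : Matrix (Fin (n + 1)) (Fin (n + 1)) R} (c : Fin n → R)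
    (h_last : ∀ i, A i (Fin.last n) = B i (Fin.last n))
    (h_castSucc : ∀ i (j : Fin n), A i j.castSucc = B i j.castSucc + c j * A i j.succ) :
    A.det = B.det := by
  rw [← Matrix.det_submatrix_equiv_self Fin.revPerm A,
    ← Matrix.det_submatrix_equiv_self Fin.revPerm B]
  refine Matrix.det_eq_of_forall_col_eq_smul_add_pred (fun j => c j.rev) (fun i => ?_)
    fun i j => ?_
  · simpa using h_last i.rev
  · simpa [Fin.rev_succ, Fin.rev_castSucc] using h_castSucc i.rev j.rev

lemma sub_pow_mul_eq_sum {u v : ℕ → ℂ} {z w : ℂ} (h : ∀ l, u (l + 1) - z * u l = w * v l)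
    (s : ℕ) {q p : ℕ} (hqp : q ≤ p) :
    u (p + s + 1) - z ^ (p + 1 - q) * u (q + s) =
      w * ∑ b ∈ Finset.Icc q p, z ^ (p - b) * v (b + s) := by
  induction p, hqp using Nat.le_induction with
  | base => simp [h]
  | succ p hp ih =>
    have h1 : ∑ b ∈ Finset.Icc q p, z ^ (p + 1 - b) * v (b + s) =
        z * ∑ b ∈ Finset.Icc q p, z ^ (p - b) * v (b + s) := by
      rw [Finset.mul_sum]
      refine Finset.sum_congr rfl fun b hb => ?_
      rw [Nat.sub_add_comm (Finset.mem_Icc.1 hb).2]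
      ring
    have h2 := h (p + s + 1)
    rw [← Finset.insert_Icc_right_eq_Icc_add_one (by omega), Finset.sum_insert (by simp), h1,
      Nat.sub_self, Nat.sub_add_comm (show q ≤ p + 1 by omega), show p + 1 + s = p + s + 1 by ring,
      pow_succ]
    linear_combination h2 + z * ih

lemma det_sum_col {R : Type*} [CommRing R] {k : ℕ} (S : Fin k → Finset ℕ)
    (g : Fin k → Fin k → ℕ → R) :
    (Matrix.of fun i j => ∑ b ∈ S j, g i j b).det =
      ∑ b ∈ Fintype.piFinset S, (Matrix.of fun i j => g i j (b j)).det := by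
  have := (Matrix.detRowAlternating (R := R) (n := Fin k)).toMultilinearMap.map_sum_finset
    (fun j b i => g i j b) S
  rw [← Matrix.det_transpose]
  simp_rw [← Matrix.det_transpose (Matrix.of fun i j => g i j _)]
  convert this using 2
  · congr 1
    ext j i
    simp
  · rfl

/-- Branching of alternants: eliminating a variable whose row is geometric. -/
lemma alternant_succ {u v : ℕ → ℕ → ℂ} {w : ℕ → ℂ} {z c : ℂ} {k : ℕ} {a : ℕ → ℕ}
    (ha : Antitone a) (h_last : ∀ l, u k l = c * z ^ l)
    (h_rec : ∀ i < k, ∀ l, u i (l + 1) - z * u i l = w i * v i l) :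
    alternant u (k + 1) a = (c * ∏ i ∈ Finset.range k, w i) *
      ∑ b ∈ interlaceBox k a,
        z ^ a k * (∏ j : Fin k, z ^ (a j - padded b j)) * alternant v k (padded b) := by
  let B : Matrix (Fin (k + 1)) (Fin (k + 1)) ℂ := Matrix.of fun i j =>
    Fin.lastCases (u i (a k)) (fun j : Fin k =>
      u i (a j + (k - 1 - j) + 1) - z ^ (a j + 1 - a (j + 1)) * u i (a (j + 1) + (k - 1 - j))) j
  have hB : alternant u (k + 1) a = B.det := by
    refine det_eq_of_forall_col_eq_smul_add_succ (fun j : Fin k => z ^ (a j + 1 - a (j + 1)))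
      (fun i => by simp [B]) fun i j => ?_
    have h1 : a j + (k - j) = a j + (k - 1 - j) + 1 := by omega
    have h2 : a (j + 1) + (k - (j + 1)) = a (j + 1) + (k - 1 - j) := by omega
    simp [B, h1, h2]
  have hrow : ∀ j : Fin k, B (Fin.last k) j.castSucc = 0 := by
    intro j
    have h1 : a j + (k - 1 - j) + 1 = (a j + 1 - a (j + 1)) + (a (j + 1) + (k - 1 - j)) := by
      have := ha (Nat.le_succ j)
      simp only [Nat.succ_eq_add_one] at this
      omega
    simp only [B, Matrix.of_apply, Fin.lastCases_castSucc, Fin.val_last, h_last]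
    rw [h1, pow_add z (a j + 1 - a (j + 1))]
    ring
  have hsub : B.submatrix Fin.castSucc Fin.castSucc = Matrix.of fun i j : Fin k =>
      w i * ∑ b ∈ Finset.Icc (a (j + 1)) (a j), z ^ (a j - b) * v i (b + (k - 1 - j)) := by
    ext i j
    simp only [B, Matrix.submatrix_apply, Matrix.of_apply, Fin.lastCases_castSucc,
      Fin.val_castSucc]
    exact sub_pow_mul_eq_sum (h_rec i i.2) _ (ha (Nat.le_succ j))
  rw [hB, Matrix.det_succ_row B (Fin.last k), Fin.sum_univ_castSucc]
  simp only [hrow, mul_zero, zero_mul, Finset.sum_const_zero, zero_add, Fin.succAbove_last, hsub]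
  have hdet := Matrix.det_mul_column (fun i : Fin k => w i) (Matrix.of fun i j : Fin k =>
    ∑ b ∈ Finset.Icc (a (j + 1)) (a j), z ^ (a j - b) * v i (b + (k - 1 - j)))
  simp only [Matrix.of_apply] at hdet
  rw [hdet, det_sum_col, Fin.prod_univ_eq_prod_range w k]
  have hlast : B (Fin.last k) (Fin.last k) = c * z ^ a k := by simp [B, h_last]
  have hterm : ∀ b : Fin k → ℕ, (Matrix.of fun i j : Fin k =>
      z ^ (a j - b j) * v i (b j + (k - 1 - j))).det =
      (∏ j : Fin k, z ^ (a j - padded b j)) * alternant v k (padded b) := by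
    intro b
    have h := Matrix.det_mul_row (fun j : Fin k => z ^ (a j - b j))
      (Matrix.of fun i j : Fin k => v i (b j + (k - 1 - j)))
    simp only [Matrix.of_apply] at h
    simp [h, alternant, padded]
  simp only [hlast, hterm, interlaceBox, Finset.mul_sum, Fin.val_last, ← two_mul, pow_mul]
  refine Finset.sum_congr rfl fun b _ => ?_
  ring

/-- Partitions, stored in `n` parts, with at most `k` nonzero parts. -/
def IsPart {n : ℕ} (k : ℕ) (a : Fin n → ℕ) : Prop :=
  Antitone a ∧ ∀ i : Fin n, k ≤ i → a i = 0

open Classical in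
/-- The partitions with at most `k` parts interlacing with `a`. -/
def interlaceFinset {n : ℕ} (k : ℕ) (a : Fin n → ℕ) : Finset (Fin n → ℕ) :=
  {b ∈ Fintype.piFinset fun i => Finset.Iic (a i) | IsPart k b ∧ Interlace a b}

lemma mem_interlaceFinset {n k : ℕ} {a b : Fin n → ℕ} :
    b ∈ interlaceFinset k a ↔ IsPart k b ∧ Interlace a b := by
  simp only [interlaceFinset, Finset.mem_filter, Fintype.mem_piFinset, Finset.mem_Iic,
    and_iff_right_iff_imp]
  exact fun h => h.2.1

lemma padded_apply {n : ℕ} (a : Fin n → ℕ) (i : Fin n) : padded a i = a i := by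
  simp [padded]

lemma padded_of_le {n i : ℕ} (a : Fin n → ℕ) (h : n ≤ i) : padded a i = 0 := by
  simp [padded, h]

lemma padded_antitone {n : ℕ} {a : Fin n → ℕ} (ha : Antitone a) : Antitone (padded a) := by
  intro i j hij
  by_cases hj : j < n
  · simpa [padded, hj, hij.trans_lt hj] using ha (Fin.mk_le_mk.2 hij)
  · simp [padded_of_le a (not_lt.1 hj)]

lemma IsPart.padded_eq_zero {n k i : ℕ} {a : Fin n → ℕ} (ha : IsPart k a) (h : k ≤ i) :
    padded a i = 0 := by
  unfold padded
  split_ifs with hi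
  exacts [ha.2 _ h, rfl]

lemma IsPart.mono {n k l : ℕ} {a : Fin n → ℕ} (ha : IsPart k a) (h : k ≤ l) : IsPart l a :=
  ⟨ha.1, fun i hi => ha.2 i (h.trans hi)⟩

lemma interlace_iff {n : ℕ} {a b : Fin n → ℕ} :
    Interlace a b ↔ ∀ i, padded b i ≤ padded a i ∧ padded a (i + 1) ≤ padded b i := by
  constructor
  · intro h i
    constructor
    · by_cases hi : i < n
      · simpa [padded, hi] using h.1 ⟨i, hi⟩
      · simp [padded_of_le _ (not_lt.1 hi)]
    · by_cases hi : i + 1 < n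
      · simpa [padded, hi, (Nat.lt_succ_self i).trans hi] using h.2 i hi
      · simp [padded_of_le _ (not_lt.1 hi)]
  · intro h
    refine ⟨fun i => by simpa [padded] using (h i).1, fun i hi => ?_⟩
    simpa [padded, hi, (Nat.lt_succ_self i).trans hi] using (h i).2

lemma Interlace.antitone {n : ℕ} {a b : Fin n → ℕ} (h : Interlace a b) : Antitone b := by
  rw [interlace_iff] at h
  have : Antitone (padded b) := antitone_nat_of_succ_le fun i => (h (i + 1)).1.trans (h i).2
  intro i j hij
  simpa [padded] using this (Fin.le_def.1 hij)

lemma wt_eq_sum_range {n k : ℕ} {a : Fin n → ℕ} (ha : IsPart k a) :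
    wt a = ∑ j ∈ Finset.range k, padded a j := by
  have h1 : wt a = ∑ j ∈ Finset.range n, padded a j := by
    simp [wt, Finset.sum_range, padded]
  rw [h1]
  rcases le_total n k with h | h
  · refine Finset.sum_subset (Finset.range_mono h) fun i _ hi => padded_of_le _ (by simpa using hi)
  · refine (Finset.sum_subset (Finset.range_mono h) fun i _ hi =>
      ha.padded_eq_zero (by simpa using hi)).symm

lemma sum_interlaceBox {n k : ℕ} (hk : k ≤ n) {a : Fin n → ℕ} (ha : IsPart (k + 1) a)
    (φ : (ℕ → ℕ) → ℂ) :
    ∑ c ∈ interlaceBox k (padded a), φ (padded c) = ∑ b ∈ interlaceFinset k a, φ (padded b) := by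
  have hpad : ∀ c : Fin k → ℕ, padded (fun i : Fin n => padded c i) = padded c := by
    intro c
    ext i
    by_cases hi : i < n
    · simp [padded, hi]
    · rw [padded_of_le _ (not_lt.1 hi), padded_of_le _ (hk.trans (not_lt.1 hi))]
  have hpad' : ∀ b : Fin n → ℕ, IsPart k b → padded (fun j : Fin k => padded b j) = padded b := by
    intro b hb
    ext i
    by_cases hi : i < k
    · simp [padded, hi]
    · rw [padded_of_le _ (not_lt.1 hi), hb.padded_eq_zero (not_lt.1 hi)]
  refine Finset.sum_nbij' (fun c i => padded c i) (fun b j => padded b j) ?_ ?_ ?_ ?_ ?_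
  · intro c hc
    have hab : Interlace a (fun i : Fin n => padded c i) := by
      rw [interlace_iff, hpad]
      intro i
      by_cases hi : i < k
      · simpa [interlaceBox, padded, hi, and_comm] using Fintype.mem_piFinset.1 hc ⟨i, hi⟩
      · rw [padded_of_le c (not_lt.1 hi), ha.padded_eq_zero (i := i + 1) (by omega)]
        simp
    exact mem_interlaceFinset.2 ⟨⟨hab.antitone, fun i hi => padded_of_le _ hi⟩, hab⟩
  · intro b hb
    have := interlace_iff.1 (mem_interlaceFinset.1 hb).2
    simp only [interlaceBox, Fintype.mem_piFinset, Finset.mem_Icc]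
    exact fun j => (this j).symm
  · intro c _
    ext j
    rw [hpad, padded_apply]
  · intro b hb
    ext j
    rw [hpad' b (mem_interlaceFinset.1 hb).1, padded_apply]
  · intro c _
    rw [hpad]

lemma pow_wt_sub {n k : ℕ} {a b : Fin n → ℕ} (ha : IsPart (k + 1) a) (hb : IsPart k b)
    (h : Interlace a b) (z : ℂ) :
    z ^ padded a k * ∏ j : Fin k, z ^ (padded a j - padded b j) = z ^ (wt a - wt b) := by
  rw [Finset.prod_pow_eq_pow_sum, ← pow_add,
    Fin.sum_univ_eq_sum_range (fun j => padded a j - padded b j) k,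
    Finset.sum_tsub_distrib _ fun j _ => (interlace_iff.1 h j).1, wt_eq_sum_range ha,
    wt_eq_sum_range hb, Finset.sum_range_succ]
  congr 1
  have := Finset.sum_le_sum fun j (_ : j ∈ Finset.range k) => (interlace_iff.1 h j).1
  omega

lemma alternant_succ_eq_sum {u v : ℕ → ℕ → ℂ} {w : ℕ → ℂ} {z c : ℂ} {n k : ℕ} (hk : k ≤ n)
    {a : Fin n → ℕ} (ha : IsPart (k + 1) a) (h_last : ∀ l, u k l = c * z ^ l)
    (h_rec : ∀ i < k, ∀ l, u i (l + 1) - z * u i l = w i * v i l) :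
    alternant u (k + 1) (padded a) = (c * ∏ i ∈ Finset.range k, w i) *
      ∑ b ∈ interlaceFinset k a, z ^ (wt a - wt b) * alternant v k (padded b) := by
  rw [alternant_succ (padded_antitone ha.1) h_last h_rec, sum_interlaceBox hk ha fun b =>
    z ^ padded a k * (∏ j : Fin k, z ^ (padded a j - b j)) * alternant v k b]
  congr 1
  refine Finset.sum_congr rfl fun b hb => ?_
  rw [pow_wt_sub ha (mem_interlaceFinset.1 hb).1 (mem_interlaceFinset.1 hb).2]

lemma alternant_eq_sum {f g : ℕ → ℕ → ℂ} {z : ℂ} {n k : ℕ} (hk : k ≤ n)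
    {a : Fin n → ℕ} (ha : IsPart k a) (h_zero : ∀ i < k, f i 0 = g i 0)
    (h_rec : ∀ i < k, ∀ l, f i (l + 1) - z * f i l = g i (l + 1)) :
    alternant f k (padded a) =
      ∑ b ∈ interlaceFinset k a, z ^ (wt a - wt b) * alternant g k (padded b) := by
  let u : ℕ → ℕ → ℂ := fun i l => if i < k then (if l = 0 then 0 else f i (l - 1)) else z ^ l
  have hu : alternant u (k + 1) (padded a) = alternant f k (padded a) := by
    rw [alternant, Matrix.det_succ_column _ (Fin.last k), Fin.sum_univ_castSucc]
    have h0 : ∀ i : Fin k, u i (padded a k + (k + 1 - 1 - k)) = 0 := by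
      simp [u, ha.padded_eq_zero le_rfl]
    simp only [Matrix.of_apply, Fin.val_last, Fin.val_castSucc, h0, mul_zero, zero_mul,
      Finset.sum_const_zero, zero_add,
      Fin.succAbove_last, ← two_mul, pow_mul]
    have h1 : u k (padded a k + (k + 1 - 1 - k)) = 1 := by
      simp [u, ha.padded_eq_zero le_rfl]
    rw [h1, alternant]
    simp only [even_two, Even.neg_pow, one_pow, one_mul]
    refine congrArg Matrix.det (Matrix.ext fun i j => ?_)
    have h1 : k - (j : ℕ) ≠ 0 := by omega
    have h2 : padded a j + (k - j) - 1 = padded a j + (k - 1 - j) := by omega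
    simp [u, h1, h2]
  rw [← hu, alternant_succ_eq_sum (w := fun _ => 1) (c := 1) (z := z) (v := g) hk
    (ha.mono (Nat.le_succ k))
    (by simp [u])]
  · simp
  · intro i hi l
    cases l with
    | zero => simp [u, hi, h_zero i hi]
    | succ l => simp [u, hi, h_rec i hi]

open Classical in
/-- Paths of length `n` ending at `a`, given by their vertices and edge labels, where
`(e, b) ∈ B k a` means that a path may pass from `b` to `a` in step `k` through `e`. -/
def paths {P E : Type*} (B : ℕ → P → Finset (E × P)) :
    (n : ℕ) → P → Finset ((Fin (n + 1) → P) × (Fin n → E))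
  | 0, a => {(fun _ => a, Fin.elim0)}
  | n + 1, a => ((B n a).sigma fun q => paths B n q.2).image fun s =>
      (Fin.snoc s.2.1 a, Fin.snoc s.2.2 s.1.1)

lemma mem_paths {P E : Type*} {B : ℕ → P → Finset (E × P)} {n : ℕ} {a : P}
    {s : (Fin (n + 1) → P) × (Fin n → E)} :
    s ∈ paths B n a ↔ s.1 (Fin.last n) = a ∧
      ∀ k : Fin n, (s.2 k, s.1 k.castSucc) ∈ B k (s.1 k.succ) := by
  induction n generalizing a with
  | zero =>
    simp only [paths, Finset.mem_singleton, IsEmpty.forall_iff, and_true, Prod.ext_iff]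
    constructor
    · rintro ⟨h, -⟩
      simp [h]
    · rintro rfl
      refine ⟨funext fun i => ?_, Subsingleton.elim _ _⟩
      rw [show i = Fin.last 0 from Fin.ext (by simp)]
  | succ n ih =>
    simp only [paths, Finset.mem_image, Finset.mem_sigma, ih]
    constructor
    · rintro ⟨⟨⟨e, b⟩, c, d⟩, ⟨hB, hc, h⟩, rfl⟩
      obtain rfl : c (Fin.last n) = b := hc
      refine ⟨by simp, Fin.lastCases ?_ fun k => ?_⟩
      · simpa using hB
      · simpa [← Fin.castSucc_succ] using h k
    · rintro ⟨rfl, h⟩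
      refine ⟨⟨(s.2 (Fin.last n), s.1 (Fin.last n).castSucc), Fin.init s.1, Fin.init s.2⟩,
        ⟨by simpa using h (Fin.last n), rfl, fun k => ?_⟩, by simp [Fin.snoc_init_self]⟩
      simpa [Fin.init] using h k.castSucc

/-- A recursion for `F` with steps `B` is solved by a sum over paths. -/
lemma eq_prod_mul_sum_paths {P E : Type*} {B : ℕ → P → Finset (E × P)} {V : ℕ → P → Prop}
    {F : ℕ → P → ℂ} {W : ℕ → P → E → P → ℂ} {C : ℕ → ℂ} {n : ℕ}
    (h_zero : ∀ a, V 0 a → F 0 a = 1)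
    (h_step : ∀ k < n, ∀ a, V (k + 1) a →
      F (k + 1) a = C k * ∑ q ∈ B k a, W k a q.1 q.2 * F k q.2)
    (h_mem : ∀ k < n, ∀ a, V (k + 1) a → ∀ q ∈ B k a, V k q.2) {a : P} (ha : V n a) :
    F n a = (∏ k ∈ Finset.range n, C k) *
      ∑ s ∈ paths B n a, ∏ k : Fin n, W k (s.1 k.succ) (s.2 k) (s.1 k.castSucc) := by
  classical
  induction n generalizing a with
  | zero => simp [h_zero a ha, paths]
  | succ n ih =>
    have ih' := fun q hq => ih (fun k hk => h_step k (hk.trans (Nat.lt_succ_self n)))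
      (fun k hk => h_mem k (hk.trans (Nat.lt_succ_self n))) (a := q) hq
    rw [h_step n (Nat.lt_succ_self n) a ha, Finset.prod_range_succ, mul_comm _ (C n), mul_assoc,
      paths, Finset.sum_image, Finset.sum_sigma]
    · congr 1
      rw [Finset.mul_sum]
      refine Finset.sum_congr rfl fun q hq => ?_
      rw [ih' q.2 (h_mem n (Nat.lt_succ_self n) a ha q hq), mul_left_comm, Finset.mul_sum]
      congr 1
      refine Finset.sum_congr rfl fun s hs => ?_
      rw [Fin.prod_univ_castSucc]
      simp only [Fin.succ_castSucc, Fin.snoc_castSucc, Fin.succ_last, Fin.snoc_last,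
        Fin.val_castSucc, Fin.val_last, (mem_paths.1 hs).1]
      rw [mul_comm]
    · rintro ⟨⟨e, b⟩, c, d⟩ h1 ⟨⟨e', b'⟩, c', d'⟩ h2 h
      simp only [Finset.coe_sigma, Set.mem_sigma_iff, Finset.mem_coe, mem_paths] at h1 h2
      simp only [Prod.mk.injEq, Fin.snoc_inj] at h
      obtain ⟨⟨rfl, -⟩, rfl, rfl⟩ := h
      obtain rfl : b = b' := h1.2.1.symm.trans h2.2.1
      rfl

/-- One step of a Gelfand–Tsetlin pattern. -/
def schurStep {n : ℕ} (k : ℕ) (a : Fin n → ℕ) : Finset (Unit × (Fin n → ℕ)) :=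
  Finset.univ ×ˢ interlaceFinset k a

/-- One step of a symplectic pattern, labelled by its intermediate partition. -/
def sympStep {n : ℕ} (k : ℕ) (a : Fin n → ℕ) : Finset ((Fin n → ℕ) × (Fin n → ℕ)) :=
  ((interlaceFinset (k + 1) a).sigma fun m => interlaceFinset k m).map
    (Equiv.sigmaEquivProd _ _).toEmbedding

lemma mem_schurStep {n k : ℕ} {a : Fin n → ℕ} {q : Unit × (Fin n → ℕ)} :
    q ∈ schurStep k a ↔ IsPart k q.2 ∧ Interlace a q.2 := by
  simp [schurStep, mem_interlaceFinset]

lemma mem_sympStep {n k : ℕ} {a : Fin n → ℕ} {q : (Fin n → ℕ) × (Fin n → ℕ)} :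
    q ∈ sympStep k a ↔
      (IsPart (k + 1) q.1 ∧ Interlace a q.1) ∧ IsPart k q.2 ∧ Interlace q.1 q.2 := by
  simp [sympStep, Finset.mem_map_equiv, mem_interlaceFinset]

/-- The bialternant formula for Schur polynomials. -/
lemma alternant_pow_eq_sum_paths (x : ℕ → ℂ) {n : ℕ} {a : Fin n → ℕ} (ha : IsPart n a) :
    alternant (fun i l => x i ^ l) n (padded a) =
      (∏ k ∈ Finset.range n, ∏ i ∈ Finset.range k, (x i - x k)) *
        ∑ s ∈ paths schurStep n a,
          ∏ k : Fin n, x k ^ (wt (s.1 k.succ) - wt (s.1 k.castSucc)) := by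
  refine eq_prod_mul_sum_paths (V := IsPart)
    (F := fun k a => alternant (fun i l => x i ^ l) k (padded a))
    (W := fun k a _ b => x k ^ (wt a - wt b)) ?_ ?_ ?_ ha
  · intro a _
    simp [alternant]
  · intro k hk a ha
    rw [alternant_succ_eq_sum (w := fun i => x i - x k) (z := x k) (c := 1)
      (v := fun i l => x i ^ l) hk.le ha (by simp) fun i _ l => by ring]
    rw [schurStep, Finset.sum_product]
    simp
  · intro k _ a _ q hq
    exact (mem_schurStep.1 hq).1

/-- The Weyl character formula for symplectic patterns. -/
lemma alternant_symp_eq_sum_paths {y : ℕ → ℂ} (hy : ∀ i, y i ≠ 0) {n : ℕ} {a : Fin n → ℕ}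
    (ha : IsPart n a) :
    alternant (fun i l => y i ^ (l + 1) - (y i)⁻¹ ^ (l + 1)) n (padded a) =
      (∏ k ∈ Finset.range n, ((y k - (y k)⁻¹) *
        ∏ i ∈ Finset.range k, (y i + (y i)⁻¹ - (y k + (y k)⁻¹)))) *
        ∑ s ∈ paths sympStep n a, ∏ k : Fin n,
          ((y k)⁻¹ ^ (wt (s.1 k.succ) - wt (s.2 k)) *
            y k ^ (wt (s.2 k) - wt (s.1 k.castSucc))) := by
  refine eq_prod_mul_sum_paths (V := IsPart)
    (F := fun k a => alternant (fun i l => y i ^ (l + 1) - (y i)⁻¹ ^ (l + 1)) k (padded a))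
    (W := fun k a m b => (y k)⁻¹ ^ (wt a - wt m) * y k ^ (wt m - wt b)) ?_ ?_ ?_ ha
  · intro a _
    simp [alternant]
  · intro k hk a ha
    have h := fun i => mul_inv_cancel₀ (hy i)
    rw [alternant_eq_sum (z := (y k)⁻¹) (g := fun i l => y i ^ (l + 1) - (y i)⁻¹ ^ (l + 1) -
      (y k)⁻¹ * (y i ^ l - (y i)⁻¹ ^ l)) hk ha (by simp) (by simp), sympStep, Finset.sum_map,
      Finset.sum_sigma, Finset.mul_sum]
    refine Finset.sum_congr rfl fun m hm => ?_
    rw [alternant_succ_eq_sum (w := fun i => y i + (y i)⁻¹ - (y k + (y k)⁻¹)) (z := y k)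
      (c := y k - (y k)⁻¹) (v := fun i l => y i ^ (l + 1) - (y i)⁻¹ ^ (l + 1)) hk.le
      (mem_interlaceFinset.1 hm).1 (fun l => by ring) fun i _ l => by
        linear_combination (y i ^ l - (y i)⁻¹ ^ l) * (h k - h i), mul_left_comm, Finset.mul_sum]
    simp [mul_assoc]
  · intro k _ a _ q hq
    exact (mem_sympStep.1 hq).2.1

lemma HasSum.mul_of_summable_norm {R ι κ : Type*} [NormedField R] [CompleteSpace R] {f : ι → R}
    {g : κ → R} {a b : R} (hf : Summable fun i => ‖f i‖) (hg : Summable fun j => ‖g j‖)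
    (hfa : HasSum f a) (hgb : HasSum g b) : HasSum (fun q : ι × κ => f q.1 * g q.2) (a * b) :=
  hfa.mul hgb (summable_mul_of_summable_norm hf hg)

lemma hasSum_prod_pi {R : Type*} [NormedField R] [CompleteSpace R] {n : ℕ} {f : Fin n → ℕ → R}
    (hf : ∀ i, Summable fun l => ‖f i l‖) :
    (Summable fun l : Fin n → ℕ => ‖∏ i, f i (l i)‖) ∧
      HasSum (fun l : Fin n → ℕ => ∏ i, f i (l i)) (∏ i, ∑' l, f i l) := by
  induction n with
  | zero =>
    have h' := hasSum_fintype fun l : Fin 0 → ℕ => ‖∏ i, f i (l i)‖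
    exact ⟨h'.summable, by simp⟩
  | succ n ih =>
    obtain ⟨h1, h2⟩ := ih (f := fun i => f i.succ) fun i => hf i.succ
    have hcons : ∀ q : ℕ × (Fin n → ℕ), ∏ i, f i (Fin.consEquiv (fun _ => ℕ) q i) =
        f 0 q.1 * ∏ i : Fin n, f i.succ (q.2 i) := fun q => by
      simp [Fin.prod_univ_succ, Fin.consEquiv]
    constructor
    · rw [← (Fin.consEquiv fun _ => ℕ).summable_iff]
      refine ((hf 0).mul_norm h1).congr fun q => ?_
      rw [Function.comp_apply, hcons]
    · rw [← (Fin.consEquiv fun _ => ℕ).hasSum_iff, Fin.prod_univ_succ]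
      have h := HasSum.mul_of_summable_norm (hf 0) h1 (hf 0).of_norm.hasSum h2
      convert h using 1
      exact funext hcons

/-- The strictly decreasing sequence attached to a partition with `n` parts. -/
def shifted {n : ℕ} (a : Fin n → ℕ) (j : Fin n) : ℕ := a j + (n - 1 - j)

lemma shifted_strictAnti {n : ℕ} {a : Fin n → ℕ} (ha : Antitone a) : StrictAnti (shifted a) := by
  intro i j hij
  have := ha hij.le
  have hij' := Fin.lt_def.1 hij
  have := j.2
  unfold shifted
  omega

lemma alternant_padded (u : ℕ → ℕ → ℂ) {n : ℕ} (a : Fin n → ℕ) :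
    alternant u n (padded a) = (Matrix.of fun i j : Fin n => u i (shifted a j)).det := by
  simp [alternant, padded, shifted]

lemma StrictAnti.add_sub_le {n : ℕ} {s : Fin n → ℕ} (hs : StrictAnti s) {i j : Fin n}
    (hij : i ≤ j) : s j + (j - i) ≤ s i := by
  have key : ∀ d : ℕ, ∀ i j : Fin n, (j : ℕ) = i + d → s j + d ≤ s i := by
    intro d
    induction d with
    | zero =>
      intro i j h
      rw [show j = i from Fin.ext h, add_zero]
    | succ d ih =>
      intro i j h
      have hj := j.2
      have h1 := ih i ⟨i + d, by omega⟩ rfl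
      have h2 : s j < s ⟨i + d, by omega⟩ := hs (Fin.lt_def.2 (by simp [h]))
      omega
  exact key _ i j (by have := Fin.le_def.1 hij; omega)

lemma exists_shifted_comp_eq {n : ℕ} {l : Fin n → ℕ} (hl : Function.Injective l) :
    ∃ a : Fin n → ℕ, Antitone a ∧ ∃ τ : Equiv.Perm (Fin n), shifted a ∘ τ = l := by
  let σ : Equiv.Perm (Fin n) := Fin.revPerm.trans (Tuple.sort l)
  have hs : StrictAnti (l ∘ σ) := by
    refine Antitone.strictAnti_of_injective (fun i j hij => ?_) (hl.comp σ.injective)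
    exact Tuple.monotone_sort l (Fin.rev_le_rev.2 hij)
  have hle : ∀ j : Fin n, n - 1 - j ≤ (l ∘ σ) j := by
    intro j
    have hj := j.2
    have := hs.add_sub_le (i := j) (j := ⟨n - 1, by omega⟩) (Fin.le_def.2 (by simp; omega))
    simp only at this
    omega
  refine ⟨fun j => (l ∘ σ) j - (n - 1 - j), fun i j hij => ?_, σ.symm, ?_⟩
  · have h1 := hs.add_sub_le hij
    have h2 := Fin.le_def.1 hij
    have h3 := hle j
    have := j.2
    dsimp only at *
    omega
  · ext i
    have := hle (σ.symm i)
    simp only [Function.comp_apply, shifted] at *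
    rw [Nat.sub_add_cancel this, Equiv.apply_symm_apply]

lemma shifted_comp_injective {n : ℕ} : Function.Injective
    fun q : {a : Fin n → ℕ // Antitone a} × Equiv.Perm (Fin n) => shifted q.1.1 ∘ q.2 := by
  rintro ⟨⟨a, ha⟩, τ⟩ ⟨⟨b, hb⟩, τ'⟩ h
  simp only at h
  have h1 : shifted a ∘ Fin.rev = shifted b ∘ Fin.rev := by
    have hmono : ∀ {a : Fin n → ℕ}, Antitone a → StrictMono (shifted a ∘ Fin.rev) :=
      fun ha => (shifted_strictAnti ha).comp Fin.rev_strictAnti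
    rw [← StrictMono.range_inj (hmono ha) (hmono hb), Fin.rev_surjective.range_comp,
      Fin.rev_surjective.range_comp, ← τ.surjective.range_comp, h, τ'.surjective.range_comp]
  have h2 : shifted a = shifted b := Fin.rev_surjective.injective_comp_right h1
  have h3 : a = b := by
    ext j
    simpa [shifted] using congrFun h2 j
  subst h3
  have h4 : τ = τ' := Equiv.ext fun i => (shifted_strictAnti ha).injective (congrFun h i)
  rw [h4]

/-- The Cauchy–Binet formula for infinite sums over partitions. -/
lemma hasSum_alternant_mul_alternant {n : ℕ} {u v : ℕ → ℕ → ℂ}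
    (h : ∀ i j : Fin n, Summable fun l => ‖u i l * v j l‖) :
    HasSum (fun a : {a : Fin n → ℕ // Antitone a} =>
        alternant u n (padded a.1) * alternant v n (padded a.1))
      (Matrix.of fun i j : Fin n => ∑' l, u i l * v j l).det := by
  let H : (Fin n → ℕ) → ℂ := fun l =>
    (Matrix.of fun i j : Fin n => u i (l j)).det * ∏ i : Fin n, v i (l i)
  have hH : HasSum H (Matrix.of fun i j : Fin n => ∑' l, u i l * v j l).det := by
    rw [Matrix.det_apply']
    have := hasSum_sum (s := Finset.univ) fun (σ : Equiv.Perm (Fin n)) _ =>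
      (hasSum_prod_pi (f := fun i l => u (σ i) l * v i l) fun i => h (σ i) i).2.mul_left
        ((Equiv.Perm.sign σ : ℤ) : ℂ)
    refine this.congr_fun fun l => ?_
    simp only [H, Matrix.det_apply', Finset.sum_mul, Matrix.of_apply, Finset.prod_mul_distrib,
      mul_assoc]
  rw [← shifted_comp_injective.hasSum_iff] at hH
  · refine HasSum.prod_fiberwise (β := {a : Fin n → ℕ // Antitone a}) hH fun a => ?_
    have hval : alternant u n (padded a.1) * alternant v n (padded a.1) =
        ∑ τ : Equiv.Perm (Fin n), H (shifted a.1 ∘ τ) := by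
      rw [alternant_padded, alternant_padded,
        ← Matrix.det_transpose (Matrix.of fun i j : Fin n => v i _),
        Matrix.det_apply' (Matrix.transpose _), Finset.mul_sum]
      refine Finset.sum_congr rfl fun τ _ => ?_
      have h' : H (shifted a.1 ∘ τ) =
          ((Matrix.of fun i j : Fin n => u i (shifted a.1 j)).submatrix id τ).det *
            ∏ i : Fin n, v i (shifted a.1 (τ i)) := rfl
      rw [h', Matrix.det_permute']
      simp only [Matrix.transpose_apply, Matrix.of_apply]
      ring
    rw [hval]
    exact hasSum_fintype _
  · intro l hl
    by_cases hinj : Function.Injective l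
    · obtain ⟨a, ha, τ, rfl⟩ := exists_shifted_comp_eq hinj
      exact absurd ⟨(⟨a, ha⟩, τ), rfl⟩ hl
    · simp only [Function.Injective, not_forall] at hinj
      obtain ⟨i, j, hij, hne⟩ := hinj
      simp only [H]
      rw [Matrix.det_zero_of_column_eq hne (by simp [hij]), zero_mul]

lemma hasSum_symp_kernel {x y t : ℂ} (hy : y ≠ 0) (h1 : ‖x * y‖ < 1) (h2 : ‖x * y⁻¹‖ < 1)
    (ht : ‖t‖ < 1) :
    (Summable fun l : ℕ => ‖x ^ l * ((1 - t ^ (l + 1)) * (y ^ (l + 1) - y⁻¹ ^ (l + 1)))‖) ∧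
      HasSum (fun l : ℕ => x ^ l * ((1 - t ^ (l + 1)) * (y ^ (l + 1) - y⁻¹ ^ (l + 1))))
        ((1 - t * x ^ 2) * (((1 - t) / ((1 - x * y) * (1 - t * (x * y)) * (1 - x * y⁻¹) *
          (1 - t * (x * y⁻¹)))) * (y - y⁻¹))) := by
  have h3 : ‖t * (x * y)‖ < 1 := by
    rw [norm_mul]
    exact mul_lt_one_of_nonneg_of_lt_one_left (norm_nonneg _) ht h1.le
  have h4 : ‖t * (x * y⁻¹)‖ < 1 := by
    rw [norm_mul]
    exact mul_lt_one_of_nonneg_of_lt_one_left (norm_nonneg _) ht h2.le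
  have hne : ∀ {z : ℂ}, ‖z‖ < 1 → 1 - z ≠ 0 := by
    intro z hz h
    rw [← sub_eq_zero.1 h] at hz
    simp at hz
  have expand : ∀ l : ℕ, x ^ l * ((1 - t ^ (l + 1)) * (y ^ (l + 1) - y⁻¹ ^ (l + 1))) =
      y * (x * y) ^ l - y⁻¹ * (x * y⁻¹) ^ l - t * y * (t * (x * y)) ^ l +
        t * y⁻¹ * (t * (x * y⁻¹)) ^ l := by
    intro l
    simp only [mul_pow, pow_succ]
    ring
  simp only [expand]
  constructor
  · have hs : ∀ {z : ℂ} (c : ℂ), ‖z‖ < 1 → Summable fun l : ℕ => ‖c * z ^ l‖ := by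
      intro z c hz
      simpa [norm_mul, norm_pow] using
        (summable_geometric_of_lt_one (norm_nonneg z) hz).mul_left ‖c‖
    refine Summable.of_nonneg_of_le (fun _ => norm_nonneg _) (fun l => ?_)
      ((((hs y h1).add (hs y⁻¹ h2)).add (hs (t * y) h3)).add (hs (t * y⁻¹) h4))
    exact (norm_add_le _ _).trans (add_le_add_left ((norm_sub_le _ _).trans
      (add_le_add_left (norm_sub_le _ _) _)) _)
  · have := ((((hasSum_geometric_of_norm_lt_one h1).mul_left y).sub
      ((hasSum_geometric_of_norm_lt_one h2).mul_left y⁻¹)).sub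
      ((hasSum_geometric_of_norm_lt_one h3).mul_left (t * y))).add
      ((hasSum_geometric_of_norm_lt_one h4).mul_left (t * y⁻¹))
    have hyy := mul_inv_cancel₀ hy
    have n1 := hne h1
    have n2 := hne h2
    have n3 := hne h3
    have n4 := hne h4
    generalize y⁻¹ = z at *
    have m1 := mul_inv_cancel₀ n1
    have m2 := mul_inv_cancel₀ n2
    have m3 := mul_inv_cancel₀ n3
    have m4 := mul_inv_cancel₀ n4
    have e1 : y * (1 - x * y)⁻¹ - z * (1 - x * z)⁻¹ = (y - z) / ((1 - x * y) * (1 - x * z)) := by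
      rw [eq_div_iff (mul_ne_zero n1 n2)]
      linear_combination y * (1 - x * z) * m1 - z * (1 - x * y) * m2
    have e2 : t * y * (1 - t * (x * y))⁻¹ - t * z * (1 - t * (x * z))⁻¹ =
        t * (y - z) / ((1 - t * (x * y)) * (1 - t * (x * z))) := by
      rw [eq_div_iff (mul_ne_zero n3 n4)]
      linear_combination t * y * (1 - t * (x * z)) * m3 - t * z * (1 - t * (x * y)) * m4
    have e3 : y * (1 - x * y)⁻¹ - z * (1 - x * z)⁻¹ - t * y * (1 - t * (x * y))⁻¹ +
        t * z * (1 - t * (x * z))⁻¹ = (1 - t * x ^ 2) * (((1 - t) / ((1 - x * y) *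
          (1 - t * (x * y)) * (1 - x * z) * (1 - t * (x * z)))) * (y - z)) := by
      rw [sub_add, e1, e2, div_sub_div _ _ (mul_ne_zero n1 n2) (mul_ne_zero n3 n4),
        div_mul_eq_mul_div, ← mul_div_assoc, div_eq_div_iff
          (mul_ne_zero (mul_ne_zero n1 n2) (mul_ne_zero n3 n4))
          (mul_ne_zero (mul_ne_zero (mul_ne_zero n1 n3) n2) n4)]
      linear_combination (y - z) * (-(1 - t) * t * x ^ 2) * ((1 - x * y) * (1 - t * (x * y)) *
        (1 - x * z) * (1 - t * (x * z))) * hyy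
    exact e3 ▸ this

lemma hasSum_symp_cauchy {n : ℕ} {x y : Fin n → ℂ} {t : ℂ} (X Y : ℕ → ℂ)
    (hX : ∀ i : Fin n, X i = x i) (hY : ∀ i : Fin n, Y i = y i) (hy : ∀ j, y j ≠ 0)
    (h1 : ∀ i j, ‖x i * y j‖ < 1) (h2 : ∀ i j, ‖x i * (y j)⁻¹‖ < 1) (ht : ‖t‖ < 1) :
    HasSum (fun a : {a : Fin n → ℕ // Antitone a} =>
        (∏ i : Fin n, (1 - t ^ (a.1 i + (n - (i : ℕ))))) *
          (alternant (fun i l => X i ^ l) n (padded a.1) *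
            alternant (fun i l => Y i ^ (l + 1) - (Y i)⁻¹ ^ (l + 1)) n (padded a.1)))
      ((∏ i, (1 - t * x i ^ 2)) * (∏ j, (y j - (y j)⁻¹)) *
        (Matrix.of fun i j : Fin n =>
          (1 - t) / ((1 - x i * y j) * (1 - t * (x i * y j)) *
            (1 - x i * (y j)⁻¹) * (1 - t * (x i * (y j)⁻¹)))).det) := by
  have hk := fun i j => hasSum_symp_kernel (hy j) (h1 i j) (h2 i j) ht
  have := hasSum_alternant_mul_alternant (n := n) (u := fun i l => X i ^ l)
    (v := fun j l => (1 - t ^ (l + 1)) * (Y j ^ (l + 1) - (Y j)⁻¹ ^ (l + 1)))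
    (fun i j => by simpa only [hX, hY] using (hk i j).1)
  simp only [hX, hY, fun i j => (hk i j).2.tsum_eq] at this
  convert this using 1
  · ext a
    have h := Matrix.det_mul_row (fun j : Fin n => 1 - t ^ (shifted a.1 j + 1))
      (Matrix.of fun i j : Fin n => Y i ^ (shifted a.1 j + 1) - (Y i)⁻¹ ^ (shifted a.1 j + 1))
    simp only [Matrix.of_apply] at h
    rw [alternant_padded (fun j l => (1 - t ^ (l + 1)) * (Y j ^ (l + 1) - (Y j)⁻¹ ^ (l + 1))),
      alternant_padded (fun i l => Y i ^ (l + 1) - (Y i)⁻¹ ^ (l + 1)), h, mul_left_comm]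
    have he : ∀ i : Fin n, a.1 i + (n - (i : ℕ)) = shifted a.1 i + 1 := by
      intro i
      have := i.2
      unfold shifted
      omega
    simp only [he]
  · let K : Matrix (Fin n) (Fin n) ℂ := Matrix.of fun i j =>
      (1 - t) / ((1 - x i * y j) * (1 - t * (x i * y j)) *
        (1 - x i * (y j)⁻¹) * (1 - t * (x i * (y j)⁻¹)))
    have e1 := Matrix.det_mul_column (fun i => 1 - t * x i ^ 2)
      (Matrix.of fun i j => K i j * (y j - (y j)⁻¹))
    have e2 := Matrix.det_mul_row (fun j => y j - (y j)⁻¹) K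
    simp only [Matrix.of_apply, K, mul_comm (_ - _⁻¹)] at e1 e2
    rw [e1, e2]
    ring

lemma summable_pow_of_injective {α ι : Type*} [Fintype ι] {f : α → ι → ℕ}
    (hf : Function.Injective f) {w : α → ℕ} (h : ∀ a i, f a i ≤ w a) {q : ℝ} (hq0 : 0 ≤ q)
    (hq1 : q < 1) : Summable fun a => q ^ w a := by
  classical
  set M := Fintype.card ι with hM
  set r : ℝ := 1 - (1 - q) / (M + 1) with hr
  have hM1 : (0 : ℝ) < M + 1 := by positivity
  have hd0 : 0 < (1 - q) / (M + 1) := div_pos (by linarith) hM1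
  have hd1 : (1 - q) / (M + 1) ≤ 1 - q := div_le_self (by linarith) (by simp)
  have hr0 : 0 ≤ r := by linarith
  have hr1 : r < 1 := by linarith
  have hrM : q ≤ r ^ M := by
    have h1 := one_add_mul_le_pow (a := -((1 - q) / (M + 1))) (by linarith) M
    have h2 : (M : ℝ) * ((1 - q) / (M + 1)) ≤ 1 - q := by
      rw [mul_div_assoc', div_le_iff₀ hM1]
      nlinarith
    rw [hr, sub_eq_add_neg]
    linarith
  have hs := (hasSum_prod_pi (n := M) (f := fun _ l => r ^ l) fun _ => by
    simpa [abs_of_nonneg hr0] using summable_geometric_of_lt_one hr0 hr1).2.summable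
  let e := Fintype.equivFin ι
  have hinj : Function.Injective fun a => f a ∘ e.symm :=
    e.symm.surjective.injective_comp_right.comp hf
  refine Summable.of_nonneg_of_le (fun a => by positivity) (fun a => ?_) (hs.comp_injective hinj)
  calc q ^ w a ≤ (r ^ M) ^ w a := pow_le_pow_left₀ hq0 hrM _
    _ = r ^ (M * w a) := (pow_mul _ _ _).symm
    _ ≤ r ^ ∑ i, f a (e.symm i) := pow_le_pow_of_le_one hr0 hr1.le (by
      simpa using Finset.sum_le_card_nsmul Finset.univ (fun i => f a (e.symm i)) (w a)
        fun i _ => h a _)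
    _ = _ := (Finset.prod_pow_eq_pow_sum _ _ _).symm

lemma sum_tsub_castSucc {n : ℕ} {f : Fin (n + 1) → ℕ} (hf : ∀ k : Fin n, f k.castSucc ≤ f k.succ) :
    ∑ k : Fin n, (f k.succ - f k.castSucc) = f (Fin.last n) - f 0 := by
  rw [Finset.sum_tsub_distrib _ fun k _ => hf k]
  have h1 := Fin.sum_univ_succ f
  have h2 := Fin.sum_univ_castSucc f
  omega

lemma Interlace.wt_le {n : ℕ} {a b : Fin n → ℕ} (h : Interlace a b) : wt b ≤ wt a :=
  Finset.sum_le_sum fun i _ => h.1 i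

lemma le_wt {n : ℕ} (a : Fin n → ℕ) (i : Fin n) : a i ≤ wt a :=
  Finset.single_le_sum (fun _ _ => Nat.zero_le _) (Finset.mem_univ i)

lemma norm_zpow_le_two_pow {y : ℂ} (h1 : 1 / 2 < ‖y‖) (h2 : ‖y‖ < 2) {e : ℤ} {m : ℕ}
    (he : e.natAbs ≤ m) : ‖y ^ e‖ ≤ 2 ^ m := by
  have h0 : 0 < ‖y‖ := by linarith
  refine le_trans ?_ (pow_le_pow_right₀ (by norm_num) he)
  rw [norm_zpow]
  rcases Int.natAbs_eq e with h | h
  · rw [h, zpow_natCast, Int.natAbs_natCast]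
    exact pow_le_pow_left₀ h0.le h2.le _
  · rw [h, zpow_neg, zpow_natCast, Int.natAbs_neg, Int.natAbs_natCast, ← inv_pow]
    refine pow_le_pow_left₀ (by positivity) ?_ _
    rw [inv_le_comm₀ h0 (by norm_num)]
    linarith

lemma summable_pow_wt (n : ℕ) :
    Summable fun p : SympPP n => (1 / 8 : ℝ) ^ wt (p.1.1 (Fin.last n)) := by
  let f : SympPP n → ((Fin (n + 1) × Fin n) ⊕ (Fin n × Fin n) ⊕ (Fin (n + 1) × Fin n)) → ℕ :=
    fun p => Sum.elim (fun i => p.1.1 i.1 i.2)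
      (Sum.elim (fun i => p.1.2.1 i.1 i.2) fun i => p.1.2.2 i.1 i.2)
  refine summable_pow_of_injective (f := f) ?_ ?_ (by norm_num) (by norm_num)
  · intro p q h
    refine Subtype.ext (Prod.ext ?_ (Prod.ext ?_ ?_)) <;> ext k i
    · exact congrFun h (Sum.inl (k, i))
    · exact congrFun h (Sum.inr (Sum.inl (k, i)))
    · exact congrFun h (Sum.inr (Sum.inr (k, i)))
  · rintro ⟨⟨l, m, v⟩, hl, hm, hv, hl0, hv0, hlv, h1, h2, h3, h4⟩
    have ml : Monotone fun k => wt (l k) := Fin.monotone_iff_le_succ.2 fun k => (h1 k).wt_le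
    have mv : Monotone fun k => wt (v k) :=
      Fin.monotone_iff_le_succ.2 fun k => (h3 k).wt_le.trans (h2 k).wt_le
    have bv : ∀ k, wt (v k) ≤ wt (l (Fin.last n)) := fun k => by
      have := mv (Fin.le_last k)
      dsimp only at *
      rwa [hlv]
    rintro (⟨k, i⟩ | ⟨k, i⟩ | ⟨k, i⟩)
    · exact (le_wt _ _).trans (ml (Fin.le_last k))
    · exact (le_wt _ _).trans ((h2 k).wt_le.trans (bv _))
    · exact (le_wt _ _).trans (bv k)

lemma norm_one_sub_pow_le {t : ℂ} (ht : ‖t‖ < 1) (m : ℕ) : ‖1 - t ^ m‖ ≤ 2 := by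
  refine (norm_sub_le _ _).trans ?_
  rw [norm_one, norm_pow]
  linarith [pow_le_one₀ (n := m) (norm_nonneg t) ht.le]

lemma summable_sympPP {n : ℕ} {x y : Fin n → ℂ} {t : ℂ} (hx : ∀ i, ‖x i‖ ≤ 1 / 16)
    (ht : ‖t‖ < 1) (hy1 : ∀ j, 1 / 2 < ‖y j‖) (hy2 : ∀ j, ‖y j‖ < 2) :
    Summable fun p : SympPP n =>
      (∏ i : Fin n, (1 - t ^ (p.1.1 (Fin.last n) i + (n - (i : ℕ))))) *
        (∏ k : Fin n, x k ^ (wt (p.1.1 k.succ) - wt (p.1.1 k.castSucc))) *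
        ∏ k : Fin n, y k ^ (2 * (wt (p.1.2.1 k) : ℤ) - (wt (p.1.2.2 k.succ) : ℤ) -
          (wt (p.1.2.2 k.castSucc) : ℤ)) := by
  refine Summable.of_norm_bounded ((summable_pow_wt n).mul_left (2 ^ n)) ?_
  rintro ⟨⟨l, m, v⟩, hl, hm, hv, hl0, hv0, hlv, h1, h2, h3, h4⟩
  change l 0 = _ at hl0
  change v 0 = _ at hv0
  change l _ = v _ at hlv
  dsimp only
  have b1 : ‖∏ i : Fin n, (1 - t ^ (l (Fin.last n) i + (n - (i : ℕ))))‖ ≤ 2 ^ n := by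
    rw [norm_prod]
    refine (Finset.prod_le_prod (fun _ _ => norm_nonneg _)
      fun i _ => norm_one_sub_pow_le ht _).trans_eq ?_
    simp
  have b2 : ‖∏ k : Fin n, x k ^ (wt (l k.succ) - wt (l k.castSucc))‖ ≤
      (1 / 16) ^ wt (l (Fin.last n)) := by
    rw [norm_prod]
    have hs := sum_tsub_castSucc (f := fun k => wt (l k)) fun k => (h1 k).wt_le
    rw [hl0, show wt (fun _ : Fin n => 0) = 0 by simp [wt], Nat.sub_zero] at hs
    rw [← hs, ← Finset.prod_pow_eq_pow_sum]
    refine Finset.prod_le_prod (fun _ _ => norm_nonneg _) fun k _ => ?_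
    rw [norm_pow]
    exact pow_le_pow_left₀ (norm_nonneg _) (hx k) _
  have b3 : ‖∏ k : Fin n, y k ^ (2 * (wt (m k) : ℤ) - (wt (v k.succ) : ℤ) -
      (wt (v k.castSucc) : ℤ))‖ ≤ 2 ^ wt (l (Fin.last n)) := by
    rw [norm_prod]
    have hs := sum_tsub_castSucc (f := fun k => wt (v k)) fun k => (h3 k).wt_le.trans (h2 k).wt_le
    rw [hv0, ← hlv, show wt (fun _ : Fin n => 0) = 0 by simp [wt], Nat.sub_zero] at hs
    rw [← hs, ← Finset.prod_pow_eq_pow_sum]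
    refine Finset.prod_le_prod (fun _ _ => norm_nonneg _) fun k _ => ?_
    have g2 : wt (m k) ≤ wt (v k.succ) := (h2 k).wt_le
    have g3 : wt (v k.castSucc) ≤ wt (m k) := (h3 k).wt_le
    exact norm_zpow_le_two_pow (hy1 k) (hy2 k) (by omega)
  rw [norm_mul, norm_mul, mul_assoc]
  refine mul_le_mul b1 ?_ (by positivity) (by positivity)
  refine (mul_le_mul b2 b3 (norm_nonneg _) (by positivity)).trans_eq ?_
  rw [← mul_pow]
  norm_num

lemma isPart_self {n : ℕ} {a : Fin n → ℕ} (ha : Antitone a) : IsPart n a :=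
  ⟨ha, fun i hi => absurd i.2 (by omega)⟩

lemma IsPart.eq_zero {n : ℕ} {a : Fin n → ℕ} (ha : IsPart 0 a) : a = fun _ => 0 :=
  funext fun i => ha.2 i (Nat.zero_le _)

lemma IsPart.of_interlace {n k : ℕ} {a b : Fin n → ℕ} (hb : IsPart k b) (h : Interlace a b)
    (ha : Antitone a) : IsPart (k + 1) a := by
  refine ⟨ha, fun i hi => ?_⟩
  have h1 := h.2 (i - 1) (by omega)
  rw [hb.2 _ (by simp only; omega)] at h1
  have h2 : (⟨(i : ℕ) - 1 + 1, by omega⟩ : Fin n) = i := Fin.ext (by simp only; omega)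
  rwa [h2, Nat.le_zero] at h1

lemma IsPart.of_interlace_left {n k : ℕ} {a b : Fin n → ℕ} (ha : IsPart k a) (h : Interlace a b)
    (hb : Antitone b) : IsPart k b :=
  ⟨hb, fun i hi => Nat.le_zero.1 ((h.1 i).trans_eq (ha.2 i hi))⟩

lemma isPart_of_forall_interlace {n : ℕ} {l : Fin (n + 1) → Fin n → ℕ} (h : ∀ k, Antitone (l k))
    (h0 : l 0 = fun _ => 0) (hl : ∀ k : Fin n, Interlace (l k.succ) (l k.castSucc))
    (k : Fin (n + 1)) : IsPart (k : ℕ) (l k) := by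
  induction k using Fin.induction with
  | zero => exact ⟨h 0, fun i _ => by rw [h0]⟩
  | succ k ih => exact ih.of_interlace (hl k) (h _)

/-- A symplectic plane partition is a pair consisting of a Gelfand–Tsetlin pattern and a
symplectic pattern of the same shape. -/
def sympPPEquiv (n : ℕ) :
    SympPP n ≃ Σ a : {a : Fin n → ℕ // Antitone a},
      ↥(paths schurStep n a.1 ×ˢ paths sympStep n a.1) where
  toFun p := ⟨⟨p.1.1 (Fin.last n), p.2.1 _⟩,
    ⟨((p.1.1, fun _ => ()), (p.1.2.2, p.1.2.1)), by
      obtain ⟨⟨l, m, v⟩, hl, hm, hv, hl0, hv0, hlv, h1, h2, h3, h4⟩ := p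
      have pl := isPart_of_forall_interlace hl hl0 h1
      have pv : ∀ k : Fin (n + 1), IsPart (k : ℕ) (v k) := fun k => ⟨hv k, h4 k⟩
      refine Finset.mem_product.2 ⟨mem_paths.2 ⟨rfl, fun k => ?_⟩,
        mem_paths.2 ⟨hlv.symm, fun k => ?_⟩⟩
      · exact mem_schurStep.2 ⟨pl k.castSucc, h1 k⟩
      · exact mem_sympStep.2 ⟨⟨(pv k.succ).of_interlace_left (h2 k) (hm k), h2 k⟩,
          pv k.castSucc, h3 k⟩⟩⟩
  invFun q := ⟨(q.2.1.1.1, q.2.1.2.2, q.2.1.2.1), by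
    obtain ⟨⟨a, ha⟩, ⟨⟨⟨l, e⟩, ⟨v, m⟩⟩, hq⟩⟩ := q
    obtain ⟨h1, h2⟩ := Finset.mem_product.1 hq
    obtain ⟨h1a, h1⟩ := mem_paths.1 h1
    obtain ⟨h2a, h2⟩ := mem_paths.1 h2
    simp only [mem_schurStep, mem_sympStep] at h1 h2 h1a h2a
    have pl : ∀ k : Fin (n + 1), IsPart (k : ℕ) (l k) :=
      Fin.lastCases (h1a ▸ isPart_self ha) fun k => (h1 k).1
    have pv : ∀ k : Fin (n + 1), IsPart (k : ℕ) (v k) :=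
      Fin.lastCases (h2a ▸ isPart_self ha) fun k => (h2 k).2.1
    exact ⟨fun k => (pl k).1, fun k => (h2 k).1.1.1, fun k => (pv k).1, (pl 0).eq_zero,
      (pv 0).eq_zero, h1a.trans h2a.symm, fun k => (h1 k).2, fun k => (h2 k).1.2,
      fun k => (h2 k).2.2, fun k => (pv k).2⟩⟩
  left_inv _ := rfl
  right_inv q := by
    obtain ⟨⟨a, ha⟩, ⟨⟨⟨l, e⟩, ⟨v, m⟩⟩, hq⟩⟩ := q
    obtain rfl : l (Fin.last n) = a := (mem_paths.1 (Finset.mem_product.1 hq).1).1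
    rfl

lemma inv_pow_mul_pow_eq_zpow {z : ℂ} (hz : z ≠ 0) {a b c : ℕ} (hab : b ≤ a) (hbc : c ≤ b) :
    z⁻¹ ^ (a - b) * z ^ (b - c) = z ^ (2 * (b : ℤ) - a - c) := by
  rw [← zpow_natCast, ← zpow_natCast, inv_zpow', ← zpow_add₀ hz]
  congr 1
  omega

lemma prod_range_prod_range_eq {n : ℕ} {R : Type*} [CommMonoid R] (F : ℕ → ℕ → R) :
    ∏ k ∈ Finset.range n, ∏ i ∈ Finset.range k, F i k =
      ∏ i : Fin n, ∏ j ∈ Finset.Ioi i, F i j := by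
  have h : ∀ i : Fin n, ∏ j ∈ Finset.Ioi i, F i j = ∏ j : Fin n, if i < j then F i j else 1 := by
    intro i
    rw [← Finset.prod_filter]
    congr 1
    ext
    simp
  simp only [h]
  rw [Finset.prod_comm, Finset.prod_range]
  refine Finset.prod_congr rfl fun k _ => ?_
  rw [← Finset.prod_filter]
  symm
  refine Finset.prod_bij (fun i _ => (i : ℕ)) ?_ ?_ ?_ ?_
  · intro i hi
    simpa using hi
  · intro i _ j _ h
    exact Fin.ext h
  · intro i hi
    have := Finset.mem_range.1 hi
    exact ⟨⟨i, by omega⟩, Finset.mem_filter.2 ⟨Finset.mem_univ _, Fin.lt_def.2 this⟩, rfl⟩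
  · intros
    rfl

/-- **Refined generating series of symplectic plane partitions** (equation (12) of the
paper): with `ȳ = y⁻¹`,
`Σ ∏_{i=1}^n (1-t^{λ⁽ⁿ⁾ᵢ-i+n+1}) ∏ᵢ xᵢ^{|λ⁽ⁱ⁾|-|λ⁽ⁱ⁻¹⁾|} yᵢ^{2|μ⁽ⁱ⁾|-|ν̄⁽ⁱ⁾|-|ν̄⁽ⁱ⁻¹⁾|}
  = ∏ᵢ(1-t xᵢ²) / (Δ(x)ₙΔ(y)ₙ ∏_{i<j}(1-ȳᵢȳⱼ))
      · det[(1-t)/((1-xᵢyⱼ)(1-t xᵢyⱼ)(1-xᵢȳⱼ)(1-t xᵢȳⱼ))]`,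
the sum being over symplectic plane partitions in the `n × 2n` box.  It is stated here
for complex values of the variables in a domain of convergence. -/
theorem refined_symplectic_plane_partition_series (n : ℕ) (hn : 1 ≤ n)
    (x y : Fin n → ℂ) (t : ℂ)
    (hx : ∀ i, ‖x i‖ < 1 / (16 * (n : ℝ) ^ 2)) (ht : ‖t‖ < 1)
    (hy1 : ∀ j, 1 / 2 < ‖y j‖) (hy2 : ∀ j, ‖y j‖ < 2)
    (hysq : ∀ j, (y j) ^ 2 ≠ 1) (hyy : ∀ i j, i ≠ j → y i * y j ≠ 1)
    (hxinj : Function.Injective x) (hyinj : Function.Injective y) :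
    HasSum
      (fun p : SympPP n =>
        (∏ i : Fin n, (1 - t ^ (p.1.1 (Fin.last n) i + (n - (i : ℕ))))) *
          (∏ k : Fin n, x k ^ (wt (p.1.1 k.succ) - wt (p.1.1 k.castSucc))) *
          ∏ k : Fin n, y k ^ (2 * (wt (p.1.2.1 k) : ℤ) - (wt (p.1.2.2 k.succ) : ℤ) -
            (wt (p.1.2.2 k.castSucc) : ℤ)))
      ((∏ i : Fin n, (1 - t * x i ^ 2)) /
          (vprod x * vprod y *
            ∏ i : Fin n, ∏ j ∈ Finset.Ioi i, (1 - (y i)⁻¹ * (y j)⁻¹)) *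
        (Matrix.of fun i j : Fin n =>
          (1 - t) / ((1 - x i * y j) * (1 - t * (x i * y j)) *
            (1 - x i * (y j)⁻¹) * (1 - t * (x i * (y j)⁻¹)))).det) := by
  have hn2 : (1 : ℝ) ≤ (n : ℝ) ^ 2 := by exact_mod_cast Nat.one_le_pow 2 n hn
  have hx' : ∀ i, ‖x i‖ < 1 / 16 := fun i => (hx i).trans_le
    (one_div_le_one_div_of_le (by norm_num) (by linarith))
  have hy0 : ∀ j, y j ≠ 0 := fun j h => by
    have := hy1 j
    norm_num [h] at this
  have hxy : ∀ i j, ‖x i * y j‖ < 1 := fun i j => by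
    rw [norm_mul]
    nlinarith [hx' i, hy2 j, norm_nonneg (x i), norm_nonneg (y j)]
  have hxy' : ∀ i j, ‖x i * (y j)⁻¹‖ < 1 := fun i j => by
    have h : ‖(y j)⁻¹‖ < 2 := by
      rw [norm_inv, inv_lt_comm₀ (by linarith [hy1 j]) (by norm_num)]
      linarith [hy1 j]
    rw [norm_mul]
    nlinarith [hx' i, norm_nonneg (x i), norm_nonneg (y j)⁻¹]
  let X : ℕ → ℂ := fun i => if h : i < n then x ⟨i, h⟩ else 0
  let Y : ℕ → ℂ := fun i => if h : i < n then y ⟨i, h⟩ else 1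
  have hX : ∀ i : Fin n, X i = x i := fun i => by simp [X]
  have hY : ∀ i : Fin n, Y i = y i := fun i => by simp [Y]
  have hY0 : ∀ i, Y i ≠ 0 := fun i => by
    by_cases h : i < n
    · simpa [Y, h] using hy0 ⟨i, h⟩
    · simp [Y, h]
  have hVx : (∏ k ∈ Finset.range n, ∏ i ∈ Finset.range k, (X i - X k)) = vprod x := by
    rw [prod_range_prod_range_eq (n := n) fun i k => X i - X k]
    simp only [hX, vprod]
  have hfac : ∀ i j : Fin n, y i + (y i)⁻¹ - (y j + (y j)⁻¹) =
      (y i - y j) * (1 - (y i)⁻¹ * (y j)⁻¹) := fun i j => by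
    have := hy0 i
    have := hy0 j
    field_simp
    ring
  have hVy : (∏ k ∈ Finset.range n, ((Y k - (Y k)⁻¹) *
      ∏ i ∈ Finset.range k, (Y i + (Y i)⁻¹ - (Y k + (Y k)⁻¹)))) =
      (∏ j, (y j - (y j)⁻¹)) * (vprod y *
        ∏ i : Fin n, ∏ j ∈ Finset.Ioi i, (1 - (y i)⁻¹ * (y j)⁻¹)) := by
    rw [Finset.prod_mul_distrib, prod_range_prod_range_eq (n := n) fun i k =>
      Y i + (Y i)⁻¹ - (Y k + (Y k)⁻¹), Finset.prod_range]
    simp only [hY, vprod, hfac, Finset.prod_mul_distrib]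
  have hVx0 : vprod x ≠ 0 := Finset.prod_ne_zero_iff.2 fun i _ => Finset.prod_ne_zero_iff.2
    fun j hj => sub_ne_zero.2 fun h => (Finset.mem_Ioi.1 hj).ne (hxinj h)
  have hVy0 : vprod y ≠ 0 := Finset.prod_ne_zero_iff.2 fun i _ => Finset.prod_ne_zero_iff.2
    fun j hj => sub_ne_zero.2 fun h => (Finset.mem_Ioi.1 hj).ne (hyinj h)
  have hVyy0 : (∏ i : Fin n, ∏ j ∈ Finset.Ioi i, (1 - (y i)⁻¹ * (y j)⁻¹)) ≠ 0 :=
    Finset.prod_ne_zero_iff.2 fun i _ => Finset.prod_ne_zero_iff.2 fun j hj =>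
      sub_ne_zero.2 fun h => hyy i j (Finset.mem_Ioi.1 hj).ne (by
        rw [← mul_inv, eq_comm, inv_eq_one] at h
        exact h)
  have hD0 : (∏ j, (y j - (y j)⁻¹)) ≠ 0 := Finset.prod_ne_zero_iff.2 fun j _ =>
    sub_ne_zero.2 fun h => hysq j (by
      rw [sq]
      nth_rewrite 2 [h]
      exact mul_inv_cancel₀ (hy0 j))
  have hsum := summable_sympPP (fun i => (hx' i).le) ht hy1 hy2
  have hcauchy := (hasSum_symp_cauchy X Y hX hY hy0 hxy hxy' ht).mul_left
    (vprod x * ((∏ j, (y j - (y j)⁻¹)) * (vprod y *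
      ∏ i : Fin n, ∏ j ∈ Finset.Ioi i, (1 - (y i)⁻¹ * (y j)⁻¹))))⁻¹
  have hval : ∀ A B C D E F : ℂ, A ≠ 0 → B ≠ 0 → C ≠ 0 → D ≠ 0 →
      (A * (B * (C * D)))⁻¹ * (E * B * F) = E / (A * C * D) * F := by
    intros
    field_simp
  rw [hval _ _ _ _ _ _ hVx0 hD0 hVy0 hVyy0] at hcauchy
  rw [← (sympPPEquiv n).symm.hasSum_iff]
  refine HasSum.sigma_of_hasSum hcauchy (fun ⟨a, ha⟩ => ?_)
    ((sympPPEquiv n).symm.summable_iff.2 hsum)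
  convert hasSum_fintype _ using 1
  rw [alternant_pow_eq_sum_paths X (isPart_self ha),
    alternant_symp_eq_sum_paths hY0 (isPart_self ha), hVx, hVy]
  rw [show ∀ A B C D E : ℂ, A * (B * C * (D * E)) = (B * D) * (A * (C * E)) from
    fun _ _ _ _ _ => by ring, inv_mul_cancel_left₀ (mul_ne_zero hVx0 (mul_ne_zero hD0
    (mul_ne_zero hVy0 hVyy0))), Finset.sum_mul_sum, ← Finset.sum_product', Finset.mul_sum,
    ← Finset.sum_coe_sort]
  refine Finset.sum_congr rfl ?_
  rintro ⟨⟨⟨l, e⟩, ⟨v, m⟩⟩, hq⟩ -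
  obtain ⟨h1, h2⟩ := Finset.mem_product.1 hq
  obtain ⟨rfl, -⟩ := mem_paths.1 h1
  simp only [hX, hY]
  have hz : ∀ k : Fin n, (y k)⁻¹ ^ (wt (v k.succ) - wt (m k)) *
      y k ^ (wt (m k) - wt (v k.castSucc)) =
      y k ^ (2 * (wt (m k) : ℤ) - (wt (v k.succ) : ℤ) - (wt (v k.castSucc) : ℤ)) := fun k => by
    have h := mem_sympStep.1 ((mem_paths.1 h2).2 k)
    exact inv_pow_mul_pow_eq_zpow (hy0 k) h.1.2.wt_le h.2.2.wt_le
  simp only [hz, ← mul_assoc]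
  rfl
end
end
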